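/- arXiv:2509.25949 — 2 statements merged into one kernel-verified Lean document; each statement's English description precedes it below -/
import Mathlib

section
/- For positive integers k, t, and n with k ≥ 1, t ≥ 2, and n = 3k + 2t, the anti-Ramsey number of the linear forest kP₃ ∪ tP₂ satisfies AR(n, kP₃ ∪ tP₂) = (3k + 2t − 3)(3k + 2t − 4)/2 + 1. -/
open SimpleGraph

/-- The number of colors used by an edge-coloring `c` of the complete graph `K_n`. -/
noncomputable def colorCount (n : ℕ) (c : Sym2 (Fin n) → ℕ) : ℕ :=
  (c '' (⊤ : SimpleGraph (Fin n)).edgeSet).ncard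

/-- The linear forest `kP₃ ∪ tP₂`: the vertex-disjoint union of `k` paths on 3 vertices
and `t` paths on 2 vertices. -/
def linearForest (k t : ℕ) : SimpleGraph (Fin k × Fin 3 ⊕ Fin t × Fin 2) :=
  SimpleGraph.fromRel (fun u v =>
    (∃ (i : Fin k) (a b : Fin 3), u = Sum.inl (i, a) ∧ v = Sum.inl (i, b) ∧ (a : ℕ) + 1 = (b : ℕ)) ∨
    (∃ j : Fin t, u = Sum.inr (j, 0) ∧ v = Sum.inr (j, 1)))

/-- `G` (edge-colored by `c`) contains a rainbow subgraph isomorphic to `F`: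
there is an injective graph homomorphism from `F` to `G` under which the edges of `F`
receive pairwise distinct colors. -/
def HasRainbowCopy {V W : Type} (F : SimpleGraph V) (G : SimpleGraph W)
    (c : Sym2 W → ℕ) : Prop :=
  ∃ f : F →g G, Function.Injective f ∧
    Set.InjOn (fun e => c (Sym2.map (⇑f) e)) F.edgeSet

/-- The anti-Ramsey number `AR(n, F)`: the maximum number of colors in an edge-coloring
of `K_n` admitting no rainbow copy of `F`. -/
noncomputable def antiRamsey {V : Type} (n : ℕ) (F : SimpleGraph V) : ℕ :=
  sSup {m | ∃ c : Sym2 (Fin n) → ℕ, colorCount n c = m ∧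
    ¬ HasRainbowCopy F (⊤ : SimpleGraph (Fin n)) c}

section GraphTiling

open Finset Classical

variable {V : Type*}

/-- `Tiling R k t S`: the vertices of `S` are partitioned into `k` paths on three vertices and
`t` edges of the graph `R`. -/
inductive Tiling (R : V → V → Prop) : ℕ → ℕ → Finset V → Prop
  | empty : Tiling R 0 0 ∅
  | edge {k t : ℕ} {S : Finset V} {a b : V} (ha : a ∈ S) (hb : b ∈ S) (hab : a ≠ b)
      (h : R a b) (hT : Tiling R k t (S \ {a, b})) : Tiling R k (t + 1) S
  | path {k t : ℕ} {S : Finset V} {x y z : V} (hx : x ∈ S) (hy : y ∈ S) (hz : z ∈ S)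
      (hxy : x ≠ y) (hyz : y ≠ z) (hxz : x ≠ z) (h : R x y) (h' : R y z)
      (hT : Tiling R k t (S \ {x, y, z})) : Tiling R (k + 1) t S

/-- The number of non-neighbours of `v` in `S`. -/
noncomputable def nonDeg (R : V → V → Prop) (S : Finset V) (v : V) : ℕ :=
  #{y ∈ S | y ≠ v ∧ ¬R v y}

/-- Twice the number of missing edges inside `S`. -/
noncomputable def nonDegSum (R : V → V → Prop) (S : Finset V) : ℕ :=
  ∑ v ∈ S, nonDeg R S v

/-- Every vertex of `S` has a neighbour in `S`. -/
def NoIsolated (R : V → V → Prop) (S : Finset V) : Prop :=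
  ∀ v ∈ S, ∃ w ∈ S, w ≠ v ∧ R v w

variable {R : V → V → Prop} {S : Finset V}

theorem card_sdiff_singleton' {a : V} (ha : a ∈ S) : #(S \ {a}) + 1 = #S := by
  have h := card_sdiff_add_card_eq_card (s := {a}) (t := S) (by simpa using ha)
  simpa using h

theorem card_sdiff_pair' {a b : V} (ha : a ∈ S) (hb : b ∈ S) (hab : a ≠ b) :
    #(S \ {a, b}) + 2 = #S := by
  have h := card_sdiff_add_card_eq_card (s := {a, b}) (t := S)
    (by intro x; simp; rintro (rfl | rfl) <;> assumption)
  rwa [card_pair hab] at h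

theorem card_sdiff_triple' {a b d : V} (ha : a ∈ S) (hb : b ∈ S) (hd : d ∈ S)
    (hab : a ≠ b) (hbd : b ≠ d) (had : a ≠ d) :
    #(S \ {a, b, d}) + 3 = #S := by
  have h := card_sdiff_add_card_eq_card (s := {a, b, d}) (t := S)
    (by intro x; simp; rintro (rfl | rfl | rfl) <;> assumption)
  rwa [card_eq_three.2 ⟨a, b, d, hab, had, hbd, rfl⟩] at h

theorem Tiling.attach {k t : ℕ} (hT : Tiling R k t S) (hR : ∀ a b, R a b → R b a) :
    ∀ x ∉ S, #{y ∈ S | ¬R x y} < 2 * t → ∃ s, t = s + 1 ∧ Tiling R (k + 1) s (insert x S) := by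
  induction hT with
  | empty => intro x _ h; simp at h
  | @edge k t S a b ha hb hab h hT ih =>
    intro x hx hlt
    have hxa : x ≠ a := by rintro rfl; exact hx ha
    have hxb : x ≠ b := by rintro rfl; exact hx hb
    by_cases h1 : R x a
    · refine ⟨t, rfl, .path (x := x) (y := a) (z := b) (by simp) (by simp [ha]) (by simp [hb])
        hxa hab hxb h1 h ?_⟩
      convert hT using 1
      ext v; simp; grind
    by_cases h2 : R x b
    · refine ⟨t, rfl, .path (x := x) (y := b) (z := a) (by simp) (by simp [hb]) (by simp [ha])
        hxb hab.symm hxa h2 (hR _ _ h) ?_⟩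
      convert hT using 1
      ext v; simp; grind
    have hc : #{y ∈ S \ {a, b} | ¬R x y} + 2 = #{y ∈ S | ¬R x y} := by
      rw [← card_sdiff_pair' (S := {y ∈ S | ¬R x y}) (a := a) (b := b) (by simp [*])
        (by simp [*]) hab]
      congr 2
      ext v; simp; tauto
    obtain ⟨s, hs, hT'⟩ := ih x (by simp [hx]) (by omega)
    subst hs
    refine ⟨s + 1, rfl, .edge (a := a) (b := b) (by simp [ha]) (by simp [hb]) hab h ?_⟩
    convert hT' using 1
    ext v; simp; grind
  | @path k t S a b d ha hb hd hab hbd had h h' hT ih =>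
    intro x hx hlt
    have hxa : x ≠ a := by rintro rfl; exact hx ha
    have hxb : x ≠ b := by rintro rfl; exact hx hb
    have hxd : x ≠ d := by rintro rfl; exact hx hd
    obtain ⟨s, hs, hT'⟩ := ih x (by simp [hx])
      (lt_of_le_of_lt (card_le_card (filter_subset_filter _ sdiff_subset)) hlt)
    refine ⟨s, hs, .path (x := a) (y := b) (z := d) (by simp [ha]) (by simp [hb]) (by simp [hd])
      hab hbd had h h' ?_⟩
    convert hT' using 1
    ext v; simp; grind

theorem Tiling.of_complete : ∀ (k t : ℕ) (S : Finset V), #S = 3 * k + 2 * t →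
    (∀ a ∈ S, ∀ b ∈ S, a ≠ b → R a b) → Tiling R k t S := by
  intro k
  induction k with
  | zero =>
    intro t
    induction t with
    | zero => intro S hS _; rw [card_eq_zero.1 hS]; exact .empty
    | succ t ih =>
      intro S hS h
      obtain ⟨a, ha, b, hb, hab⟩ := one_lt_card.1 (by omega : 1 < #S)
      have := card_sdiff_pair' ha hb hab
      exact .edge ha hb hab (h a ha b hb hab) (ih _ (by omega) fun x hx y hy =>
        h x (sdiff_subset hx) y (sdiff_subset hy))
  | succ k ih =>
    intro t S hS h
    obtain ⟨a, b, d, ha, hb, hd, hab, had, hbd⟩ := two_lt_card_iff.1 (by omega : 2 < #S)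
    have := card_sdiff_triple' ha hb hd hab hbd had
    exact .path ha hb hd hab hbd had (h a ha b hb hab) (h b hb d hd hbd)
      (ih _ _ (by omega) fun x hx y hy => h x (sdiff_subset hx) y (sdiff_subset hy))

theorem nonDeg_sdiff_singleton (R : V → V → Prop) {z : V} (hz : z ∈ S) (v : V) :
    nonDeg R S v = nonDeg R (S \ {z}) v + if z ≠ v ∧ ¬R v z then 1 else 0 := by
  unfold nonDeg
  split_ifs with h
  · rw [← card_sdiff_singleton' (S := {y ∈ S | y ≠ v ∧ ¬R v y}) (a := z) (by simp [*])]
    congr 2; ext w; simp; tauto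
  · congr 1; ext w; simp; grind

theorem nonDegSum_sdiff_singleton (hR : ∀ a b, R a b → R b a) {z : V} (hz : z ∈ S) :
    nonDegSum R S = nonDegSum R (S \ {z}) + 2 * nonDeg R S z := by
  unfold nonDegSum
  rw [← sum_sdiff (s₁ := {z}) (s₂ := S) (by simpa using hz), sum_singleton]
  rw [sum_congr rfl (fun v _ => nonDeg_sdiff_singleton R hz v), sum_add_distrib]
  have : ∑ v ∈ S \ {z}, (if z ≠ v ∧ ¬R v z then 1 else 0) = nonDeg R S z := by
    rw [← card_filter]; unfold nonDeg
    congr 1; ext w; simp; grind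
  omega

theorem nonDegSum_sdiff_pair (hR : ∀ a b, R a b → R b a) {a b : V} (ha : a ∈ S) (hb : b ∈ S)
    (hab : a ≠ b) :
    nonDegSum R S + (if R a b then 0 else 2) =
      nonDegSum R (S \ {a, b}) + 2 * nonDeg R S a + 2 * nonDeg R S b := by
  have h1 := nonDegSum_sdiff_singleton hR ha
  have hb' : b ∈ S \ {a} := by simp [hb, hab.symm]
  have h2 := nonDegSum_sdiff_singleton hR hb'
  have h3 := nonDeg_sdiff_singleton R ha b
  have h4 : (S \ {a}) \ {b} = S \ {a, b} := by ext; simp; tauto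
  rw [h4] at h2
  have h5 : R a b ↔ R b a := ⟨hR _ _, hR _ _⟩
  by_cases h : R b a <;> simp [h, h5, hab] at h3 ⊢ <;> omega

theorem nonDeg_le_nonDegSum {v : V} (hv : v ∈ S) : nonDeg R S v ≤ nonDegSum R S :=
  single_le_sum (f := fun v => nonDeg R S v) (fun _ _ => Nat.zero_le _) hv

theorem nonDeg_add_degree (R : V → V → Prop) {v : V} (hv : v ∈ S) :
    nonDeg R S v + #{y ∈ S | y ≠ v ∧ R v y} + 1 = #S := by
  rw [← card_sdiff_singleton' hv,
    ← card_filter_add_card_filter_not (s := S \ {v}) (fun y => R v y), nonDeg]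
  have h1 : {y ∈ S | y ≠ v ∧ R v y} = {y ∈ S \ {v} | R v y} := by ext; simp; tauto
  have h2 : {y ∈ S | y ≠ v ∧ ¬R v y} = {y ∈ S \ {v} | ¬R v y} := by ext; simp; tauto
  rw [h1, h2]; omega

/-- If all neighbours of `v` lie in `X`, then `v` misses all other vertices. -/
theorem le_nonDeg {v : V} {X : Finset V} (hv : v ∈ S)
    (h : ∀ y ∈ S, y ≠ v → R v y → y ∈ X) : #S ≤ nonDeg R S v + 1 + #X := by
  have h1 := nonDeg_add_degree R hv
  have h2 : #{y ∈ S | y ≠ v ∧ R v y} ≤ #X := card_le_card (by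
    intro y; simp; exact fun a b c => h y a b c)
  omega

theorem nonDeg_mono {T : Finset V} (h : T ⊆ S) (v : V) : nonDeg R T v ≤ nonDeg R S v :=
  card_le_card (filter_subset_filter _ h)

theorem noIsolated_of_nonDeg (h : ∀ v ∈ S, nonDeg R S v + 2 ≤ #S) : NoIsolated R S := by
  intro v hv
  have h1 := nonDeg_add_degree R hv
  have := h v hv
  obtain ⟨w, hw⟩ := card_pos.1 (by omega : 0 < #{y ∈ S | y ≠ v ∧ R v y})
  simp at hw
  exact ⟨w, hw⟩

theorem exists_max_nonDeg (R : V → V → Prop) (hS : S.Nonempty) :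
    ∃ z ∈ S, ∀ v ∈ S, nonDeg R S v ≤ nonDeg R S z :=
  exists_max_image S (nonDeg R S) hS

theorem complete_of_nonDegSum (h : nonDegSum R S = 0) : ∀ a ∈ S, ∀ b ∈ S, a ≠ b → R a b := by
  intro a ha b hb hab
  by_contra hr
  have h1 : 0 < nonDeg R S a := card_pos.2 ⟨b, by simp [hb, hab.symm, hr]⟩
  have := nonDeg_le_nonDegSum (R := R) ha
  omega

end GraphTiling

section GraphTiling

open Finset Classical

variable {V : Type*} {R : V → V → Prop} {S : Finset V}

theorem exists_isolated (h : ¬NoIsolated R S) : ∃ v ∈ S, ∀ w ∈ S, w ≠ v → ¬R v w := by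
  unfold NoIsolated at h; push Not at h; exact h

/-- Five vertices, at most five missing edges, nobody isolated. -/
theorem Tiling.one_one (hR : ∀ a b, R a b → R b a) (hS : #S = 5)
    (hD : nonDegSum R S ≤ 10) (hI : NoIsolated R S) : Tiling R 1 1 S := by
  suffices h : ∃ a ∈ S, ∃ b ∈ S, ∃ c ∈ S, ∃ d ∈ S, a ≠ b ∧ a ≠ c ∧ a ≠ d ∧ b ≠ c ∧ b ≠ d ∧
      c ≠ d ∧ R a b ∧ R c d by
    obtain ⟨a, ha, b, hb, c, hc, d, hd, hab, hac, had, hbc, hbd, hcd, h1, h2⟩ := h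
    have e1 := card_sdiff_pair' ha hb hab
    have hc' : c ∈ S \ {a, b} := by simp [*, hac.symm, hbc.symm]
    have hd' : d ∈ S \ {a, b} := by simp [*, had.symm, hbd.symm]
    have e2 := card_sdiff_pair' hc' hd' hcd
    obtain ⟨x, hx⟩ := card_pos.1 (by omega : 0 < #((S \ {a, b}) \ {c, d}))
    have hx' := hx
    simp at hx'
    obtain ⟨⟨hxS, hxa, hxb⟩, hxc, hxd⟩ := hx'
    have e0 := card_sdiff_singleton' hxS
    have hT : Tiling R 0 2 (S \ {x}) := by
      refine .edge (a := a) (b := b) (by simp [ha]; tauto) (by simp [hb]; tauto) hab h1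
        (.edge (a := c) (b := d) (by simp [hc]; tauto) (by simp [hd]; tauto) hcd h2 ?_)
      have : ((S \ {x}) \ {a, b}) \ {c, d} = (((S \ {a, b}) \ {c, d}) \ {x}) := by
        ext; simp; tauto
      rw [this]
      have e3 := card_sdiff_singleton' hx
      rw [card_eq_zero.1 (by omega : #(((S \ {a, b}) \ {c, d}) \ {x}) = 0)]
      exact .empty
    obtain ⟨s, hs, hT'⟩ := hT.attach hR x (by simp) (by
      obtain ⟨w, hw, hwx, hxw⟩ := hI x hxS
      have : #{y ∈ S \ {x} | ¬R x y} < #(S \ {x}) := by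
        apply card_lt_card
        refine ⟨filter_subset _ _, fun h => ?_⟩
        have := h (show w ∈ S \ {x} by simp [*])
        simp [hxw] at this
      omega)
    obtain rfl : s = 1 := by omega
    convert hT' using 1
    ext v; simp; grind
  by_contra hno
  push Not at hno
  obtain ⟨z, hz⟩ := card_pos.1 (by omega : 0 < #S)
  obtain ⟨w, hw, hwz, hzw⟩ := hI z hz
  have e1 := card_sdiff_pair' hz hw hwz.symm
  obtain ⟨p, q, s, hpq, hps, hqs, hpqs⟩ := card_eq_three.1 (by omega : #(S \ {z, w}) = 3)
  have hp : p ∈ S \ {z, w} := by simp [hpqs]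
  have hq : q ∈ S \ {z, w} := by simp [hpqs]
  have hs : s ∈ S \ {z, w} := by simp [hpqs]
  simp at hp hq hs
  have key : ∀ a ∈ S, ∀ b ∈ S, a ≠ b → R a b → ∀ c ∈ S, ∀ d ∈ S, c ≠ a → c ≠ b → d ≠ a → d ≠ b →
      c ≠ d → ¬R c d := fun a ha b hb hab h c hc d hd h1 h2 h3 h4 h5 =>
    hno a ha b hb c hc d hd hab h1.symm h3.symm h2.symm h4.symm h5 h
  have k := key z hz w hw hwz.symm hzw
  have dp : ∀ {v : V} (X : Finset V), v ∈ S → (∀ y ∈ X, y ∈ S ∧ y ≠ v ∧ ¬R v y) →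
      #X ≤ nonDeg R S v := fun X _ h => card_le_card fun y hy => by simp [h y hy]
  have hcase : ∀ a b, a ∈ S → b ∈ S → a ≠ b → R a b →
      (∀ y ∈ S, y = a ∨ y = b ∨ y = p ∨ y = q ∨ y = s) →
      p ≠ a → q ≠ a → s ≠ a → p ≠ b → q ≠ b → s ≠ b → (¬ R p q) → (¬R p s) → (¬R q s) →
      R p b → False := by
    intro a b ha hb hab hr hall hpa hqa hsa hpb hqb hsb n1 n2 n3 hpb'
    have n4 : ¬R a q := key p hp.1 b hb hpb hpb' a ha q hq.1 hpa.symm hab hpq.symm hqb hqa.symm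
    have n5 : ¬R a s := key p hp.1 b hb hpb hpb' a ha s hs.1 hpa.symm hab hps.symm hsb hsa.symm
    have hqb' : R q b := by
      obtain ⟨y, hy, hyq, hqy⟩ := hI q hq.1
      rcases hall y hy with rfl | rfl | rfl | rfl | rfl
      · exact absurd (hR _ _ hqy) n4
      · exact hqy
      · exact absurd (hR _ _ hqy) n1
      · exact absurd rfl hyq
      · exact absurd hqy n3
    have n6 : ¬R a p := key q hq.1 b hb hqb hqb' a ha p hp.1 hqa.symm hab hpq hpb hpa.symm
    have d1 := dp {q, s, a} hp.1 (by
      simp [*, hpq.symm, hps.symm, hpa.symm]; exact fun h => n6 (hR _ _ h))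
    have d2 := dp {p, s, a} hq.1 (by
      simp [*, hqs.symm, hqa.symm]; exact ⟨fun h => n1 (hR _ _ h), fun h => n4 (hR _ _ h)⟩)
    have d3 := dp {p, q, a} hs.1 (by
      simp [*, hsa.symm]
      exact ⟨fun h => n2 (hR _ _ h), fun h => n3 (hR _ _ h), fun h => n5 (hR _ _ h)⟩)
    have d4 := dp {p, q, s} ha (by simp [*])
    rw [card_eq_three.2 ⟨_, _, _, hqs, hqa, hsa, rfl⟩] at d1
    rw [card_eq_three.2 ⟨_, _, _, hps, hpa, hsa, rfl⟩] at d2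
    rw [card_eq_three.2 ⟨_, _, _, hpq, hpa, hqa, rfl⟩] at d3
    rw [card_eq_three.2 ⟨_, _, _, hpq, hps, hqs, rfl⟩] at d4
    have : ∑ v ∈ {p, q, s, a}, nonDeg R S v ≤ nonDegSum R S :=
      sum_le_sum_of_subset (by intro x; simp; rintro (rfl | rfl | rfl | rfl) <;> tauto)
    rw [sum_insert (by simp; tauto), sum_insert (by simp; tauto), sum_insert (by simp; tauto),
      sum_singleton] at this
    omega
  have n1 : ¬R p q := k p hp.1 q hq.1 (by tauto) (by tauto) (by tauto) (by tauto) hpq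
  have n2 : ¬R p s := k p hp.1 s hs.1 (by tauto) (by tauto) (by tauto) (by tauto) hps
  have n3 : ¬R q s := k q hq.1 s hs.1 (by tauto) (by tauto) (by tauto) (by tauto) hqs
  have hall : ∀ y ∈ S, y = z ∨ y = w ∨ y = p ∨ y = q ∨ y = s := by
    intro y hy
    by_cases h1 : y = z; · tauto
    by_cases h2 : y = w; · tauto
    have : y ∈ S \ {z, w} := mem_sdiff.2 ⟨hy, by simp [h1, h2]⟩
    rw [hpqs] at this; simpa [h1, h2] using this
  obtain ⟨y, hy, hyp, hpy⟩ := hI p hp.1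
  rcases hall y hy with rfl | rfl | rfl | rfl | rfl
  · exact hcase w y hw hz hwz (hR _ _ hzw)
      (fun v hv => by have := hall v hv; tauto) (by tauto) (by tauto) (by tauto)
      (by tauto) (by tauto) (by tauto) n1 n2 n3 hpy
  · exact hcase z y hz hw hwz.symm hzw
      (fun v hv => by have := hall v hv; tauto) (by tauto) (by tauto) (by tauto)
      (by tauto) (by tauto) (by tauto) n1 n2 n3 hpy
  · exact hyp rfl
  · exact n1 hpy
  · exact n2 hpy

theorem Tiling.one_left (hR : ∀ a b, R a b → R b a) : ∀ (t : ℕ) (S : Finset V), 1 ≤ t →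
    #S = 3 + 2 * t → nonDegSum R S + 10 ≤ 4 * #S → NoIsolated R S → Tiling R 1 t S := by
  intro t
  induction t with
  | zero => intro S h; omega
  | succ t ih =>
    intro S _ hS hD hI
    rcases Nat.eq_zero_or_pos t with rfl | ht
    · exact .one_one hR (by omega) (by omega) hI
    obtain ⟨z, hz, hmax⟩ := exists_max_nonDeg R (card_pos.1 (by omega : 0 < #S))
    by_cases hΔ : 4 ≤ nonDeg R S z
    · obtain ⟨w, hw, hwz, hzw⟩ := hI z hz
      have e1 := card_sdiff_pair' hz hw hwz.symm
      have e2 := nonDegSum_sdiff_pair hR hz hw hwz.symm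
      rw [if_pos hzw] at e2
      by_cases hI' : NoIsolated R (S \ {z, w})
      · exact .edge hz hw hwz.symm hzw (ih _ ht (by omega) (by omega) hI')
      obtain ⟨x, hx, hxiso⟩ := exists_isolated hI'
      simp at hx
      obtain ⟨hxS, hxz, hxw⟩ := hx
      have hNx : ∀ y ∈ S, y ≠ x → R x y → y = z ∨ y = w := by
        intro y hy hyx hr
        by_contra hne
        exact hxiso y (by simp; tauto) hyx hr
      have dx := le_nonDeg (X := {z, w}) hxS (fun y hy h h' => by simpa using hNx y hy h h')
      have := card_le_two (a := z) (b := w)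
      have hxz' := hmax x hxS
      have e3 := nonDegSum_sdiff_pair hR hz hxS (Ne.symm hxz)
      have e4 := card_sdiff_pair' hz hxS (Ne.symm hxz)
      by_cases hr : R z x
      · rw [if_pos hr] at e3
        refine .edge hz hxS (Ne.symm hxz) hr (ih _ ht (by omega) (by omega)
          (noIsolated_of_nonDeg fun v hv => ?_))
        have := nonDeg_le_nonDegSum (R := R) hv
        omega
      · rw [if_neg hr] at e3
        have dx' := le_nonDeg (X := {w}) hxS (fun y hy h h' => by
          rcases hNx y hy h h' with rfl | rfl
          · exact absurd (hR _ _ h') hr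
          · simp)
        rw [card_singleton] at dx'
        have hxw' : R x w := by
          obtain ⟨y, hy, hyx, hxy⟩ := hI x hxS
          rcases hNx y hy hyx hxy with rfl | rfl
          · exact absurd (hR _ _ hxy) hr
          · exact hxy
        have hc := complete_of_nonDegSum (R := R) (S := S \ {z, x}) (by omega)
        have e5 := card_sdiff_triple' hz hw hxS hwz.symm (Ne.symm hxw) (Ne.symm hxz)
        refine .path hz hw hxS hwz.symm (Ne.symm hxw) (Ne.symm hxz) hzw (hR _ _ hxw')
          (Tiling.of_complete _ _ _ (by omega) fun a ha b hb => hc a ?_ b ?_)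
        · simp at ha ⊢; tauto
        · simp at hb ⊢; tauto
    · by_cases hex : ∃ u ∈ S, ∃ v ∈ S, u ≠ v ∧ R u v ∧
          nonDegSum R S + 18 ≤ 4 * #S + 2 * (nonDeg R S u + nonDeg R S v)
      · obtain ⟨u, hu, v, hv, huv, hr, hg⟩ := hex
        have e1 := card_sdiff_pair' hu hv huv
        have e2 := nonDegSum_sdiff_pair hR hu hv huv
        rw [if_pos hr] at e2
        refine .edge hu hv huv hr (ih _ ht (by omega) (by omega)
          (noIsolated_of_nonDeg fun x hx => ?_))
        have h1 := nonDeg_mono (R := R) (S := S) (T := S \ {u, v}) sdiff_subset x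
        have h2 := hmax x (sdiff_subset hx)
        omega
      exfalso
      push Not at hex
      have hN : ∀ v ∈ S, z ≠ v → R z v →
          4 * #S + 2 * (nonDeg R S z + nonDeg R S v) < nonDegSum R S + 18 :=
        fun v hv h h' => hex z hz v hv h h'
      obtain ⟨w, hw, hwz, hzw⟩ := hI z hz
      have hw' := hN w hw hwz.symm hzw
      have h1 : nonDegSum R S ≤ ∑ v ∈ S, if v ≠ z ∧ R z v then
          min (nonDeg R S z) (3 - nonDeg R S z) else nonDeg R S z := by
        refine sum_le_sum fun v hv => ?_
        have := hmax v hv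
        split_ifs with h
        · have := hN v hv (Ne.symm h.1) h.2
          omega
        · exact this
      rw [sum_ite, sum_const, sum_const] at h1
      have h2 := nonDeg_add_degree R hz
      have h3 := card_filter_add_card_filter_not (s := S) (fun y => y ≠ z ∧ R z y)
      have h4 : nonDeg R S z ≤ 3 := by omega
      set d := #{y ∈ S | y ≠ z ∧ R z y}
      set d' := #{y ∈ S | ¬(y ≠ z ∧ R z y)}
      interval_cases h : nonDeg R S z <;> simp at h1 <;> omega

theorem Tiling.of_nonDegSum (hR : ∀ a b, R a b → R b a) : ∀ (k t : ℕ) (S : Finset V), 1 ≤ k →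
    1 ≤ t → #S = 3 * k + 2 * t → nonDegSum R S + 10 ≤ 4 * #S → NoIsolated R S →
    Tiling R k t S := by
  intro k
  induction k with
  | zero => intro t S h; omega
  | succ k ih =>
    intro t S _ ht hS hD hI
    rcases Nat.eq_zero_or_pos k with rfl | hk
    · exact .one_left hR t S ht (by omega) hD hI
    obtain ⟨z, hz, hmax⟩ := exists_max_nonDeg R (card_pos.1 (by omega : 0 < #S))
    have c1 := card_sdiff_singleton' hz
    have e1 := nonDegSum_sdiff_singleton hR hz
    have hIR : NoIsolated R (S \ {z}) := by
      by_contra hno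
      obtain ⟨v, hv, hiso⟩ := exists_isolated hno
      simp at hv
      have h1 := le_nonDeg (X := {z}) hv.1 (fun y hy h h' => by
        by_contra hne; simp at hne; exact hiso y (by simp [*]) h h')
      rw [card_singleton] at h1
      have h2 := hmax v hv.1
      obtain ⟨y, hy, hyv, hvy⟩ := hI v hv.1
      have hyz : y = z := by
        by_contra hne; exact hiso y (by simp [*]) hyv hvy
      have h3 := nonDegSum_sdiff_pair hR hv.1 hz hv.2
      rw [if_pos (hyz ▸ hvy)] at h3
      omega
    by_cases hΔ : nonDeg R S z ≤ 3
    · have hlow : nonDegSum R S ≤ #S * nonDeg R S z := by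
        have := sum_le_card_nsmul S (nonDeg R S) _ hmax
        simpa [nonDegSum] using this
      have hT := ih (t + 1) (S \ {z}) hk (by omega) (by omega) (by
        interval_cases h : nonDeg R S z <;> omega) hIR
      obtain ⟨s, hs, hT'⟩ := hT.attach hR z (by simp) (by
        have : #{y ∈ S \ {z} | ¬R z y} ≤ nonDeg R S z := card_le_card (by
          intro y; simp; tauto)
        omega)
      obtain rfl : s = t := by omega
      convert hT' using 1
      ext v; simp; grind
    push Not at hΔ
    set T := S \ {z} with hTdef
    have step : ∀ y ∈ T, ∀ b ∈ T, y ≠ b → R z y → R y b →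
        nonDegSum R T + 22 ≤ 4 * #S + 2 * (nonDeg R T y + nonDeg R T b) →
        NoIsolated R (T \ {y, b}) → Tiling R (k + 1) t S := by
      intro y hy b hb hyb h1 h2 h3 h4
      have e2 := nonDegSum_sdiff_pair hR hy hb hyb
      rw [if_pos h2] at e2
      have c2 := card_sdiff_pair' hy hb hyb
      have hy' := hy
      have hb' := hb
      simp [T] at hy' hb'
      refine .path hz hy'.1 hb'.1 (Ne.symm hy'.2) hyb (Ne.symm hb'.2) h1 h2 ?_
      have : S \ {z, y, b} = T \ {y, b} := by ext; simp [T]; tauto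
      rw [this]
      exact ih t _ hk ht (by omega) (by omega) h4
    have isoN : ∀ y b x, x ∈ T → x ∈ T \ {y, b} → (∀ w ∈ T \ {y, b}, w ≠ x → ¬R x w) →
        ∀ w ∈ T, w ≠ x → R x w → w = y ∨ w = b := by
      intro y b x _ _ hiso w hw hwx hxw
      by_contra hne
      exact hiso w (by simp; tauto) hwx hxw
    have hmaxT : ∀ v ∈ T, nonDeg R T v ≤ nonDeg R S z := fun v hv =>
      (nonDeg_mono sdiff_subset v).trans (hmax v (sdiff_subset hv))
    have isoDeg : ∀ y b x, x ∈ T → (∀ w ∈ T, w ≠ x → R x w → w = y ∨ w = b) →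
        #T ≤ nonDeg R T x + 3 := by
      intro y b x hx h
      have h1 := le_nonDeg (X := {y, b}) hx (fun w hw h' h'' => by simpa using h w hw h' h'')
      have h2 := card_le_two (a := y) (b := b)
      omega
    by_cases hbad : ∃ y ∈ T, ∃ b ∈ T, y ≠ b ∧ R z y ∧ R y b ∧ ¬NoIsolated R (T \ {y, b})
    · obtain ⟨y, hy, b, hb, hyb, hzy, hyb', hno⟩ := hbad
      obtain ⟨x, hx, hiso⟩ := exists_isolated hno
      have hxT : x ∈ T := sdiff_subset hx
      have hNx := isoN y b x hxT hx hiso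
      have dx := isoDeg y b x hxT hNx
      have mx := hmaxT x hxT
      simp at hx
      obtain ⟨_, hxy, hxb⟩ := hx
      by_cases hr : R y x
      · refine step y hy x hxT (Ne.symm hxy) hzy hr (by omega) ?_
        by_contra hno'
        obtain ⟨x', hx', hiso'⟩ := exists_isolated hno'
        have hx'T : x' ∈ T := sdiff_subset hx'
        have hNx' := isoN y x x' hx'T hx' hiso'
        have dx' := isoDeg y x x' hx'T hNx'
        simp at hx'
        obtain ⟨_, hx'y, hx'x⟩ := hx'
        have e3 := nonDegSum_sdiff_pair hR hxT hx'T (Ne.symm hx'x)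
        by_cases hr' : R x x'
        · rw [if_pos hr'] at e3; omega
        · rw [if_neg hr'] at e3
          have h1 := le_nonDeg (X := {y}) hx'T (fun w hw h h' => by
            rcases hNx' w hw h h' with rfl | rfl
            · simp
            · exact absurd (hR _ _ h') hr')
          rw [card_singleton] at h1
          have := hmaxT x' hx'T
          omega
      · have hN1 : ∀ w ∈ T, w ≠ x → R x w → w = b := fun w hw h h' => by
          rcases hNx w hw h h' with rfl | rfl
          · exact absurd (hR _ _ h') hr
          · rfl
        have hxb' : R x b := by
          obtain ⟨w, hw, hwx, hxw⟩ := hIR x hxT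
          exact hN1 w hw hwx hxw ▸ hxw
        have h1 := le_nonDeg (X := {b}) hxT (fun w hw h h' => by simpa using hN1 w hw h h')
        rw [card_singleton] at h1
        have hex : ∃ d ∈ T, d ≠ b ∧ d ≠ y ∧ R y d := by
          by_contra hno'
          push Not at hno'
          have h2 := le_nonDeg (X := {b}) hy (fun w hw h h' => by
            by_contra hne; simp at hne
            exact hno' w hw hne h h')
          rw [card_singleton] at h2
          have e3 := nonDegSum_sdiff_pair hR hxT hy hxy
          split_ifs at e3 <;> omega
        obtain ⟨d, hd, hdb, hdy, hyd⟩ := hex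
        have hdx : d ≠ x := by rintro rfl; exact hr hyd
        have hdeg : 1 ≤ nonDeg R T d := card_pos.2 ⟨x, by
          simp [hxT, hdx.symm]; exact fun h => hdb (hN1 d hd hdx (hR _ _ h))⟩
        refine step y hy d hd hdy.symm hzy hyd (by omega) ?_
        by_contra hno'
        obtain ⟨x', hx', hiso'⟩ := exists_isolated hno'
        have hx'T : x' ∈ T := sdiff_subset hx'
        have hNx' := isoN y d x' hx'T hx' hiso'
        have dx' := isoDeg y d x' hx'T hNx'
        simp at hx'
        obtain ⟨_, hx'y, hx'd⟩ := hx'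
        have hx'x : x ≠ x' := by
          rintro rfl
          rcases hNx' b hb (Ne.symm hxb) hxb' with h | h
          · exact hyb h.symm
          · exact hdb h.symm
        have hr' : ¬R x x' := by
          intro h
          obtain rfl := hN1 x' hx'T hx'x.symm h
          rcases hNx' x hxT hx'x (hR _ _ h) with h' | h'
          · exact hxy h'
          · exact hdx h'.symm
        have e3 := nonDegSum_sdiff_pair hR hxT hx'T hx'x
        rw [if_neg hr'] at e3
        omega
    · push Not at hbad
      obtain ⟨y, hyS, hyz, hzy⟩ := hI z hz
      have hy : y ∈ T := by simp [T, *]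
      by_contra hT
      have hg : ∀ b ∈ T, b ≠ y → R y b →
          4 * #S + 2 * (nonDeg R T y + nonDeg R T b) < nonDegSum R T + 22 := by
        intro b hb hby hr
        by_contra hlt
        exact hT (step y hy b hb hby.symm hzy hr (by omega) (hbad y hy b hb hby.symm hzy hr))
      obtain ⟨b, hb, hby, hyb⟩ := hIR y hy
      have h0 := hg b hb hby hyb
      have h1 : nonDegSum R T ≤ ∑ v ∈ T, if v ≠ y ∧ R y v then 1 - nonDeg R T y else
          if v = y then nonDeg R T y else nonDeg R S z := by
        refine sum_le_sum fun v hv => ?_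
        have := hmaxT v hv
        split_ifs with h h'
        · have := hg v hv h.1 h.2
          omega
        · rw [h']
        · exact this
      rw [sum_ite, sum_const, sum_ite, sum_const, sum_const] at h1
      have h2 := nonDeg_add_degree R hy
      have h3 : #{x ∈ {x ∈ T | ¬(x ≠ y ∧ R y x)} | x = y} ≤ 1 := card_le_one.2 (by
        intro a ha b hb; simp at ha hb; rw [ha.2, hb.2])
      have h4 : #{x ∈ {x ∈ T | ¬(x ≠ y ∧ R y x)} | ¬x = y} = nonDeg R T y := by
        unfold nonDeg; congr 1; ext; simp; tauto
      rw [h4] at h1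
      have h5 : nonDeg R T y ≤ 1 := by omega
      set d := #{x ∈ T | x ≠ y ∧ R y x}
      interval_cases h : nonDeg R T y
      · simp only [smul_eq_mul] at h1; omega
      · simp only [smul_eq_mul] at h1; omega

end GraphTiling

section Coloring

open Finset Classical

variable {V : Type*}

/-- The set of colours of the edges inside `S`. -/
noncomputable def cols (c : V → V → ℕ) (S : Finset V) : Finset ℕ :=
  S.offDiag.image fun p => c p.1 p.2

/-- `RainbowTiling c k t S A`: the vertices of `S` are partitioned into `k` paths on three vertices
and `t` edges whose edges have pairwise distinct colours, the set of these colours being `A`. -/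
inductive RainbowTiling (c : V → V → ℕ) : ℕ → ℕ → Finset V → Finset ℕ → Prop
  | empty : RainbowTiling c 0 0 ∅ ∅
  | edge {k t : ℕ} {S : Finset V} {A : Finset ℕ} {a b : V} (ha : a ∈ S) (hb : b ∈ S) (hab : a ≠ b)
      (h : c a b ∉ A) (hT : RainbowTiling c k t (S \ {a, b}) A) :
      RainbowTiling c k (t + 1) S (insert (c a b) A)
  | path {k t : ℕ} {S : Finset V} {A : Finset ℕ} {x y z : V} (hx : x ∈ S) (hy : y ∈ S) (hz : z ∈ S)
      (hxy : x ≠ y) (hyz : y ≠ z) (hxz : x ≠ z) (h : c x y ∉ A) (h' : c y z ∉ A)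
      (h'' : c x y ≠ c y z) (hT : RainbowTiling c k t (S \ {x, y, z}) A) :
      RainbowTiling c (k + 1) t S (insert (c x y) (insert (c y z) A))

variable {c : V → V → ℕ} {S : Finset V} {R : V → V → Prop}

theorem mem_cols {γ : ℕ} : γ ∈ cols c S ↔ ∃ a ∈ S, ∃ b ∈ S, a ≠ b ∧ c a b = γ := by
  simp [cols]; grind

theorem mem_cols_of {a b : V} (ha : a ∈ S) (hb : b ∈ S) (hab : a ≠ b) : c a b ∈ cols c S :=
  mem_cols.2 ⟨a, ha, b, hb, hab, rfl⟩

theorem cols_mono {T : Finset V} (h : T ⊆ S) : cols c T ⊆ cols c S := by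
  intro γ hγ
  obtain ⟨a, ha, b, hb, hab, rfl⟩ := mem_cols.1 hγ
  exact mem_cols_of (h ha) (h hb) hab

theorem RainbowTiling.subset_cols {k t : ℕ} {A : Finset ℕ} (h : RainbowTiling c k t S A) :
    A ⊆ cols c S := by
  induction h with
  | empty => simp
  | edge ha hb hab h hT ih =>
    exact insert_subset (mem_cols_of ha hb hab) (ih.trans (cols_mono sdiff_subset))
  | path hx hy hz hxy hyz hxz h h' h'' hT ih =>
    exact insert_subset (mem_cols_of hx hy hxy) (insert_subset (mem_cols_of hy hz hyz)
      (ih.trans (cols_mono sdiff_subset)))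

theorem RainbowTiling.of_comp {φ : ℕ → ℕ} {k t : ℕ} {A : Finset ℕ}
    (h : RainbowTiling (fun a b => φ (c a b)) k t S A) :
    ∃ A', A = A'.image φ ∧ RainbowTiling c k t S A' := by
  induction h with
  | empty => exact ⟨∅, by simp, .empty⟩
  | edge ha hb hab h hT ih =>
    obtain ⟨A', rfl, hT'⟩ := ih
    exact ⟨_, by simp, .edge ha hb hab (fun h' => h (mem_image_of_mem _ h')) hT'⟩
  | path hx hy hz hxy hyz hxz h h' h'' hT ih =>
    obtain ⟨A', rfl, hT'⟩ := ih
    exact ⟨_, by simp, .path hx hy hz hxy hyz hxz (fun h1 => h (mem_image_of_mem _ h1))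
      (fun h1 => h' (mem_image_of_mem _ h1)) (fun h1 => h'' (congrArg φ h1)) hT'⟩

theorem Tiling.rainbow
    (hinj : ∀ a b a' b', R a b → R a' b' → c a b = c a' b' → (a = a' ∧ b = b') ∨ (a = b' ∧ b = a'))
    {k t : ℕ} (hT : Tiling R k t S) :
    ∃ A, RainbowTiling c k t S A ∧ ∀ γ ∈ A, ∃ a ∈ S, ∃ b ∈ S, R a b ∧ c a b = γ := by
  induction hT with
  | empty => exact ⟨∅, .empty, by simp⟩
  | @edge k t S a b ha hb hab h hT ih =>
    obtain ⟨A, hA, hA'⟩ := ih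
    refine ⟨_, .edge ha hb hab ?_ hA, ?_⟩
    · intro hmem
      obtain ⟨x, hx, y, hy, hr, hxy⟩ := hA' _ hmem
      simp at hx hy
      rcases hinj _ _ _ _ hr h hxy with h1 | h1 <;> tauto
    · intro γ hγ
      rcases mem_insert.1 hγ with rfl | hγ
      · exact ⟨a, ha, b, hb, h, rfl⟩
      · obtain ⟨x, hx, y, hy, h1⟩ := hA' _ hγ
        exact ⟨x, sdiff_subset hx, y, sdiff_subset hy, h1⟩
  | @path k t S a b d ha hb hd hab hbd had h h' hT ih =>
    obtain ⟨A, hA, hA'⟩ := ih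
    refine ⟨_, .path ha hb hd hab hbd had ?_ ?_ ?_ hA, ?_⟩
    · intro hmem
      obtain ⟨x, hx, y, hy, hr, hxy⟩ := hA' _ hmem
      simp at hx hy
      rcases hinj _ _ _ _ hr h hxy with h1 | h1 <;> tauto
    · intro hmem
      obtain ⟨x, hx, y, hy, hr, hxy⟩ := hA' _ hmem
      simp at hx hy
      rcases hinj _ _ _ _ hr h' hxy with h1 | h1 <;> tauto
    · intro h1
      rcases hinj _ _ _ _ h h' h1 with h2 | h2 <;> tauto
    · intro γ hγ
      rcases mem_insert.1 hγ with rfl | hγ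
      · exact ⟨a, ha, b, hb, h, rfl⟩
      rcases mem_insert.1 hγ with rfl | hγ
      · exact ⟨b, hb, d, hd, h', rfl⟩
      · obtain ⟨x, hx, y, hy, h1⟩ := hA' _ hγ
        exact ⟨x, sdiff_subset hx, y, sdiff_subset hy, h1⟩

/-- The graph formed by the edges `p γ`, `γ ∈ C`. -/
def repGraph (C : Finset ℕ) (p : ℕ → V × V) (a b : V) : Prop :=
  ∃ γ ∈ C, p γ = (a, b) ∨ p γ = (b, a)

theorem repGraph_symm {C : Finset ℕ} {p : ℕ → V × V} (a b : V) (h : repGraph C p a b) :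
    repGraph C p b a := by
  obtain ⟨γ, hγ, h⟩ := h; exact ⟨γ, hγ, h.symm⟩

theorem nonDegSum_repGraph_le (hc : ∀ a b, c a b = c b a) {C : Finset ℕ} {p : ℕ → V × V}
    (hp : ∀ γ ∈ C, (p γ).1 ∈ S ∧ (p γ).2 ∈ S ∧ (p γ).1 ≠ (p γ).2 ∧ c (p γ).1 (p γ).2 = γ) :
    nonDegSum (repGraph C p) S + 2 * #C + #S ≤ #S * #S := by
  have h1 : ∑ v ∈ S, (nonDeg (repGraph C p) S v + #{y ∈ S | y ≠ v ∧ repGraph C p v y} + 1) =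
      #S * #S := by
    rw [sum_congr rfl fun v hv => nonDeg_add_degree (repGraph C p) hv]
    simp
  have h2 : ∑ v ∈ S, #{y ∈ S | y ≠ v ∧ repGraph C p v y} =
      #{q ∈ S ×ˢ S | q.2 ≠ q.1 ∧ repGraph C p q.1 q.2} := by
    rw [card_filter, sum_product]
    exact sum_congr rfl fun v _ => card_filter _ _
  have h3 : 2 * #C ≤ #{q ∈ S ×ˢ S | q.2 ≠ q.1 ∧ repGraph C p q.1 q.2} := by
    have hi : Set.InjOn p C := by
      intro a ha b hb hab
      rw [← (hp a ha).2.2.2, ← (hp b hb).2.2.2, hab]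
    have hi' : Set.InjOn (fun γ => (p γ).swap) C := fun a ha b hb hab =>
      hi ha hb (Prod.swap_injective hab)
    have hd : Disjoint (C.image p) (C.image fun γ => (p γ).swap) := by
      rw [Finset.disjoint_left]
      intro q hq hq'
      simp at hq hq'
      obtain ⟨a, ha, rfl⟩ := hq
      obtain ⟨b, hb, hab⟩ := hq'
      have e : a = b := by
        rw [← (hp a ha).2.2.2, ← (hp b hb).2.2.2, ← hab, hc]; rfl
      subst e
      have := congrArg Prod.fst hab
      exact (hp a ha).2.2.1 this.symm
    rw [two_mul, ← card_image_of_injOn hi]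
    nth_rewrite 2 [card_image_of_injOn hi]
    rw [← card_image_of_injOn hi', ← card_union_of_disjoint hd]
    apply card_le_card
    intro q hq
    simp only [mem_union, mem_image] at hq
    rcases hq with ⟨a, ha, rfl⟩ | ⟨a, ha, rfl⟩
    · have := hp a ha
      simp only [mem_filter, mem_product]
      exact ⟨⟨this.1, this.2.1⟩, this.2.2.1.symm, a, ha, .inl rfl⟩
    · have := hp a ha
      simp only [mem_filter, mem_product]
      exact ⟨⟨this.2.1, this.1⟩, this.2.2.1, a, ha, .inr rfl⟩
  rw [sum_add_distrib, sum_add_distrib, h2, sum_const, smul_eq_mul, mul_one] at h1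
  have : nonDegSum (repGraph C p) S = ∑ v ∈ S, nonDeg (repGraph C p) S v := rfl
  omega

theorem choose_sub_two_ident {n : ℕ} (hn : 2 ≤ n) :
    n * n = 2 * (n - 2).choose 2 + 5 * n - 6 := by
  obtain ⟨m, rfl⟩ := Nat.exists_eq_add_of_le hn
  rw [show 2 + m - 2 = m by omega, Nat.choose_two_right,
    Nat.mul_div_cancel' (Nat.even_mul_pred_self m).two_dvd]
  rcases m with _ | m
  · rfl
  · simp only [Nat.add_sub_cancel]; ring_nf; omega

/-- A colouring with many colours other than `q` in which every vertex sees a colour other than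
`q` has a rainbow tiling avoiding `q`. -/
theorem rainbowTiling_avoiding (hc : ∀ a b, c a b = c b a) {k t q : ℕ} (hk : 1 ≤ k) (ht : 1 ≤ t)
    (hS : #S = 3 * k + 2 * t) (hr : (#S - 2).choose 2 + 2 ≤ #((cols c S).erase q))
    (hq : ∀ z ∈ S, ∃ w ∈ S, w ≠ z ∧ c z w ≠ q) :
    ∃ A, RainbowTiling c k t S A ∧ q ∉ A := by
  set C := (cols c S).erase q with hC
  have hC' : ∀ γ ∈ C, ∃ p : V × V, p.1 ∈ S ∧ p.2 ∈ S ∧ p.1 ≠ p.2 ∧ c p.1 p.2 = γ := by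
    intro γ hγ
    obtain ⟨a, ha, b, hb, hab, h⟩ := mem_cols.1 (mem_of_mem_erase hγ)
    exact ⟨(a, b), ha, hb, hab, h⟩
  have hident := choose_sub_two_ident (n := #S) (by omega)
  have finish : ∀ p : ℕ → V × V,
      (∀ γ ∈ C, (p γ).1 ∈ S ∧ (p γ).2 ∈ S ∧ (p γ).1 ≠ (p γ).2 ∧ c (p γ).1 (p γ).2 = γ) →
      NoIsolated (repGraph C p) S → ∃ A, RainbowTiling c k t S A ∧ q ∉ A := by
    intro p hp hI
    have h1 := nonDegSum_repGraph_le hc hp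
    obtain ⟨A, hA, hA'⟩ := (Tiling.of_nonDegSum (repGraph_symm (C := C) (p := p)) k t S hk ht hS
      (by omega) hI).rainbow (c := c) (by
        rintro a b a' b' ⟨γ, hγ, h⟩ ⟨γ', hγ', h'⟩ he
        have h1 := (hp γ hγ).2.2.2
        have h2 := (hp γ' hγ').2.2.2
        have e1 : c a b = γ := by
          rcases h with h | h <;> rw [h] at h1
          · exact h1
          · rw [hc]; exact h1
        have e2 : c a' b' = γ' := by
          rcases h' with h' | h' <;> rw [h'] at h2
          · exact h2
          · rw [hc]; exact h2
        obtain rfl : γ = γ' := by rw [← e1, ← e2, he]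
        rcases h with h | h <;> rcases h' with h' | h' <;> rw [h] at h' <;>
          simp at h' <;> tauto)
    refine ⟨A, hA, fun hmem => ?_⟩
    obtain ⟨a, _, b, _, ⟨γ, hγ, h⟩, hab⟩ := hA' q hmem
    have h1 := (hp γ hγ).2.2.2
    have : γ = q := by
      rcases h with h | h <;> rw [h] at h1
      · rw [← h1, hab]
      · rw [← h1, ← hab, hc]
    exact (mem_erase.1 hγ).1 this
  have : Nonempty V := by
    obtain ⟨z, _⟩ := card_pos.1 (by omega : 0 < #S); exact ⟨z⟩
  choose! p hp using hC'
  by_cases hI : NoIsolated (repGraph C p) S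
  · exact finish p hp hI
  obtain ⟨z, hz, hiso⟩ := exists_isolated hI
  obtain ⟨w, hw, hwz, hzw⟩ := hq z hz
  have hp' : ∀ γ ∈ C, (Function.update p (c z w) (z, w) γ).1 ∈ S ∧
      (Function.update p (c z w) (z, w) γ).2 ∈ S ∧ (Function.update p (c z w) (z, w) γ).1 ≠
      (Function.update p (c z w) (z, w) γ).2 ∧ c (Function.update p (c z w) (z, w) γ).1
      (Function.update p (c z w) (z, w) γ).2 = γ := by
    intro γ hγ
    by_cases h : γ = c z w
    · subst h; simp [hz, hw, hwz.symm]
    · simpa [Function.update_of_ne h] using hp γ hγ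
  refine finish _ hp' ?_
  have h1 := nonDegSum_repGraph_le hc hp'
  set p' := Function.update p (c z w) (z, w)
  have hzw' : repGraph C p' z w :=
    ⟨c z w, mem_erase.2 ⟨hzw, mem_cols_of hz hw hwz.symm⟩, by simp [p']⟩
  have dz := le_nonDeg (R := repGraph C p') (X := {w}) hz (by
    rintro y hy hyz ⟨γ, hγ, h⟩
    by_cases hγ' : γ = c z w
    · subst hγ'; simp [p'] at h; simp; grind
    · simp only [p', Function.update_of_ne hγ'] at h
      exact absurd ⟨γ, hγ, h⟩ (hiso y hy hyz))
  rw [card_singleton] at dz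
  intro v hv
  by_contra hno
  push Not at hno
  have hvz : v ≠ z := by rintro rfl; exact hno w hw hwz hzw'
  have dv := le_nonDeg (R := repGraph C p') (X := ∅) hv (fun y hy h h' => absurd h' (hno y hy h))
  have := nonDegSum_sdiff_pair (repGraph_symm (C := C) (p := p')) hz hv hvz.symm
  simp at dv
  split_ifs at this <;> omega

end Coloring

section Bad

open Finset Classical

variable {V : Type*} {c : V → V → ℕ} {S : Finset V}

/-- The colours all of whose edges meet `{u, v}`. -/
noncomputable def lost (c : V → V → ℕ) (S : Finset V) (u v : V) : Finset ℕ :=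
  {γ ∈ cols c S | γ ∉ cols c (S \ {u, v})}

/-- After deleting `u` and `v`, all edges at `z` have the colour of `uv`. -/
def Isolates (c : V → V → ℕ) (S : Finset V) (u v z : V) : Prop :=
  (u ∈ S ∧ v ∈ S ∧ z ∈ S) ∧ (u ≠ v ∧ z ≠ u ∧ z ≠ v) ∧
    ∀ y ∈ S, y ≠ u → y ≠ v → y ≠ z → c z y = c u v

/-- A colouring for which no edge can be removed in the induction. -/
structure Bad (c : V → V → ℕ) (S : Finset V) : Prop where
  symm : ∀ a b, c a b = c b a
  seven_le : 7 ≤ #S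
  card_cols : #(cols c S) = (#S - 3).choose 2 + 2
  priv : ∀ u ∈ S, ∀ v ∈ S, u ≠ v → c u v ∉ cols c (S \ {u, v}) → 2 * #S ≤ #(lost c S u v) + 8
  nonpriv : ∀ u ∈ S, ∀ v ∈ S, u ≠ v → c u v ∈ cols c (S \ {u, v}) → (∀ z, ¬Isolates c S u v z) →
    #S ≤ #(lost c S u v) + 4

theorem card_lost (u v : V) : #(lost c S u v) + #(cols c (S \ {u, v})) = #(cols c S) := by
  have h := card_filter_add_card_filter_not (s := cols c S) (fun γ => γ ∈ cols c (S \ {u, v}))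
  have h1 : {γ ∈ cols c S | γ ∈ cols c (S \ {u, v})} = cols c (S \ {u, v}) := by
    ext γ; simp; exact fun h => cols_mono sdiff_subset h
  rw [h1] at h
  unfold lost
  omega

theorem notMem_cols_sdiff {γ : ℕ} {u v : V} : γ ∉ cols c (S \ {u, v}) ↔
    ∀ a ∈ S, ∀ b ∈ S, a ≠ b → c a b = γ → a = u ∨ a = v ∨ b = u ∨ b = v := by
  rw [mem_cols]
  simp only [mem_sdiff, mem_insert, mem_singleton]
  grind

theorem mem_lost {γ : ℕ} {u v : V} : γ ∈ lost c S u v ↔ γ ∈ cols c S ∧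
    ∀ a ∈ S, ∀ b ∈ S, a ≠ b → c a b = γ → a = u ∨ a = v ∨ b = u ∨ b = v := by
  rw [lost, mem_filter, notMem_cols_sdiff]

theorem lost_comm (u v : V) : lost c S u v = lost c S v u := by
  unfold lost; rw [pair_comm]

theorem Isolates.mem_cols (h : Isolates c S u v z) (hS : 4 ≤ #S) : c u v ∈ cols c (S \ {u, v}) := by
  obtain ⟨⟨hu, hv, hz⟩, ⟨huv, hzu, hzv⟩, h⟩ := h
  have := card_sdiff_triple' hu hv hz huv hzv.symm hzu.symm
  obtain ⟨y, hy⟩ := card_pos.1 (by omega : 0 < #(S \ {u, v, z}))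
  simp at hy
  rw [← h y hy.1 hy.2.1 hy.2.2.1 hy.2.2.2]
  exact mem_cols_of (by simp [*]) (by simp [*]) (Ne.symm hy.2.2.2)

theorem Isolates.swap (hc : ∀ a b, c a b = c b a) {u v z : V} (h : Isolates c S u v z) :
    Isolates c S v u z := by
  obtain ⟨⟨hu, hv, hz⟩, ⟨huv, hzu, hzv⟩, h⟩ := h
  exact ⟨⟨hv, hu, hz⟩, ⟨huv.symm, hzv, hzu⟩, fun y hy h1 h2 h3 => by
    rw [hc v u]
    exact h y hy h2 h1 h3⟩

theorem Bad.le_lost (h : Bad c S) {u v : V} (hu : u ∈ S) (hv : v ∈ S) (huv : u ≠ v)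
    (hI : ∀ z, ¬Isolates c S u v z) : #S ≤ #(lost c S u v) + 4 := by
  have := h.seven_le
  by_cases hp : c u v ∈ cols c (S \ {u, v})
  · exact h.nonpriv u hu v hv huv hp hI
  · have := h.priv u hu v hv huv hp
    omega

theorem card_hitting {u v : V} (hu : u ∈ S) (hv : v ∈ S) (huv : u ≠ v) :
    #{p ∈ S.offDiag | p.1 = u ∨ p.1 = v ∨ p.2 = u ∨ p.2 = v} + 6 = 4 * #S := by
  have h := card_filter_add_card_filter_not (s := S.offDiag)
    (fun p => p.1 = u ∨ p.1 = v ∨ p.2 = u ∨ p.2 = v)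
  have h1 : {p ∈ S.offDiag | ¬(p.1 = u ∨ p.1 = v ∨ p.2 = u ∨ p.2 = v)} = (S \ {u, v}).offDiag := by
    ext p; simp; tauto
  rw [h1, offDiag_card, offDiag_card] at h
  have h2 := card_sdiff_pair' hu hv huv
  set m := #(S \ {u, v})
  rw [← h2] at h ⊢
  have : (m + 2) * (m + 2) = m * m + 4 * m + 4 := by ring
  have : m ≤ m * m := Nat.le_mul_self m
  omega

/-- The ordered pairs of colour `γ`. -/
noncomputable def colorClass (c : V → V → ℕ) (S : Finset V) (γ : ℕ) : Finset (V × V) :=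
  {p ∈ S.offDiag | c p.1 p.2 = γ}

/-- The ordered pairs meeting all edges of colour `γ`. -/
noncomputable def coverPairs (c : V → V → ℕ) (S : Finset V) (γ : ℕ) : Finset (V × V) :=
  {p ∈ S.offDiag | γ ∉ cols c (S \ {p.1, p.2})}

theorem sum_card_lost : ∑ p ∈ S.offDiag, #(lost c S p.1 p.2) =
    ∑ γ ∈ cols c S, #(coverPairs c S γ) :=
  sum_card_bipartiteAbove_eq_sum_card_bipartiteBelow
    (fun (p : V × V) γ => γ ∉ cols c (S \ {p.1, p.2}))

theorem sum_card_colorClass : ∑ γ ∈ cols c S, #(colorClass c S γ) = #S * #S - #S := by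
  rw [← offDiag_card, card_eq_sum_card_fiberwise (f := fun p : V × V => c p.1 p.2) (t := cols c S)]
  · rfl
  · intro p hp; exact mem_image_of_mem _ hp

theorem card_coverPairs_le (γ : ℕ) (hγ : γ ∈ cols c S) : #(coverPairs c S γ) + 6 ≤ 4 * #S := by
  obtain ⟨a, ha, b, hb, hab, rfl⟩ := mem_cols.1 hγ
  rw [← card_hitting ha hb hab, add_le_add_iff_right]
  apply card_le_card
  intro p hp
  simp only [coverPairs, mem_filter, notMem_cols_sdiff] at hp ⊢
  have := hp.2 a ha b hb hab rfl
  exact ⟨hp.1, by tauto⟩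

theorem card_colorClass_le {γ : ℕ} (h : (coverPairs c S γ).Nonempty) :
    #(colorClass c S γ) + 6 ≤ 4 * #S := by
  obtain ⟨p, hp⟩ := h
  simp only [coverPairs, mem_filter, notMem_cols_sdiff, mem_offDiag] at hp
  rw [← card_hitting hp.1.1 hp.1.2.1 hp.1.2.2, add_le_add_iff_right]
  apply card_le_card
  intro q hq
  simp only [colorClass, mem_filter, mem_offDiag] at hq ⊢
  exact ⟨hq.1, hp.2 q.1 hq.1.1 q.2 hq.1.2.1 hq.1.2.2 hq.2⟩

theorem colorClass_pair (hc : ∀ a b, c a b = c b a) {a b : V} (ha : a ∈ S) (hb : b ∈ S)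
    (hab : a ≠ b) : {(a, b), (b, a)} ⊆ colorClass c S (c a b) := by
  intro p hp
  simp at hp
  rcases hp with rfl | rfl <;> simp [colorClass, *, hab.symm, hc b a]

theorem card_coverPairs_le_of_ne_two (hc : ∀ a b, c a b = c b a) (hS : 4 ≤ #S) {γ : ℕ}
    (hγ : γ ∈ cols c S) (h2 : #(colorClass c S γ) ≠ 2) : #(coverPairs c S γ) ≤ 2 * #S := by
  obtain ⟨a, ha, b, hb, hab, rfl⟩ := mem_cols.1 hγ
  have hsub := colorClass_pair hc ha hb hab
  have hne : {(a, b), (b, a)} ≠ colorClass c S (c a b) := by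
    intro h; rw [← h, card_pair (by simp [hab])] at h2; exact h2 rfl
  obtain ⟨⟨x, y⟩, hp, hp'⟩ := exists_of_ssubset (hsub.ssubset_of_ne hne)
  simp only [colorClass, mem_filter, mem_offDiag] at hp
  obtain ⟨⟨hx, hy, hxy⟩, hcol⟩ := hp
  simp at hp'
  have share : ∀ a b d : V, a ∈ S → b ∈ S → d ∈ S → a ≠ b → a ≠ d → b ≠ d → c a d = c a b →
      #(coverPairs c S (c a b)) ≤ 2 * #S := by
    intro a b d ha hb hd hab had hbd h
    have h1 : coverPairs c S (c a b) ⊆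
        ({a} ×ˢ (S \ {a}) ∪ (S \ {a}) ×ˢ {a}) ∪ {(b, d), (d, b)} := by
      intro p hp
      simp only [coverPairs, mem_filter, notMem_cols_sdiff, mem_offDiag] at hp
      have e1 := hp.2 a ha b hb hab rfl
      have e2 := hp.2 a ha d hd had h
      obtain ⟨p1, p2⟩ := p
      simp at hp ⊢
      grind
    have h2 := card_sdiff_singleton' ha
    have h3 := (card_le_card h1).trans ((card_union_le _ _).trans
      (Nat.add_le_add (card_union_le _ _) (card_le_two)))
    simp only [card_product, card_singleton] at h3
    omega
  by_cases h1 : x = a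
  · subst h1
    exact share x b y hx hb hy hab hxy (by grind) hcol
  by_cases h2 : x = b
  · subst h2
    rw [hc a x]
    exact share x a y hx ha hy hab.symm hxy (by grind) (by rw [hcol, hc])
  by_cases h3 : y = a
  · subst h3
    exact share y b x hy hb hx hab hxy.symm (by grind) (by rw [hc, hcol])
  by_cases h4 : y = b
  · subst h4
    rw [hc a y]
    exact share y a x hy ha hx hab.symm hxy.symm (by grind) (by rw [hc y x, hcol, hc])
  have hsub : coverPairs c S (c a b) ⊆ ({a, b} ×ˢ {x, y}) ∪ ({x, y} ×ˢ {a, b}) := by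
    intro p hp
    simp only [coverPairs, mem_filter, notMem_cols_sdiff, mem_offDiag] at hp
    have e1 := hp.2 a ha b hb hab rfl
    have e2 := hp.2 x hx y hy hxy hcol
    obtain ⟨p1, p2⟩ := p
    simp at hp ⊢
    grind
  have h5 := (card_le_card hsub).trans (card_union_le _ _)
  rw [card_product, card_product, card_pair hab, card_pair hxy] at h5
  omega

theorem choose_sub_three_ident {n : ℕ} (hn : 3 ≤ n) :
    2 * (n - 3).choose 2 + 7 * n = n * n + 12 := by
  obtain ⟨m, rfl⟩ := Nat.exists_eq_add_of_le hn
  rw [show 3 + m - 3 = m by omega, Nat.choose_two_right,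
    Nat.mul_div_cancel' (Nat.even_mul_pred_self _).two_dvd]
  have : m * (m - 1) + m = m * m := by cases m <;> simp; ring
  nlinarith

theorem Bad.exists_isolates (h : Bad c S) : ∃ u v z, Isolates c S u v z := by
  by_contra hno
  push Not at hno
  have hn := h.seven_le
  have hident := choose_sub_three_ident (by omega : 3 ≤ #S)
  have hr := h.card_cols
  set U := {γ ∈ cols c S | #(colorClass c S γ) = 2} with hU
  set W := {γ ∈ cols c S | ¬#(colorClass c S γ) = 2} with hW
  have hUW : #U + #W = #(cols c S) := card_filter_add_card_filter_not _
  have hlow : ∑ p ∈ S.offDiag, ((#S - 4) + if c p.1 p.2 ∈ U then #S - 4 else 0) ≤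
      ∑ p ∈ S.offDiag, #(lost c S p.1 p.2) := by
    refine sum_le_sum fun p hp => ?_
    rw [mem_offDiag] at hp
    obtain ⟨p1, p2⟩ := p
    dsimp only at hp ⊢
    split_ifs with hpU
    · have hsub := colorClass_pair h.symm hp.1 hp.2.1 hp.2.2
      have heq := eq_of_subset_of_card_le hsub (by
        rw [(mem_filter.1 hpU).2, card_pair (by simp [hp.2.2])])
      have := h.priv p1 hp.1 p2 hp.2.1 hp.2.2 (by
        rw [notMem_cols_sdiff]
        intro a ha b hb hab hcab
        have : (a, b) ∈ colorClass c S (c p1 p2) := by simp [colorClass, *]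
        rw [← heq] at this
        simp at this
        tauto)
      omega
    · have := h.le_lost hp.1 hp.2.1 hp.2.2 (fun z => hno _ _ z)
      omega
  rw [sum_add_distrib, sum_const, ← sum_filter, sum_const, sum_card_lost, smul_eq_mul, smul_eq_mul,
    offDiag_card] at hlow
  have hcount : #{p ∈ S.offDiag | c p.1 p.2 ∈ U} = 2 * #U := by
    rw [card_eq_sum_card_fiberwise (f := fun p : V × V => c p.1 p.2) (t := U) (by
      intro p hp; exact (mem_filter.1 hp).2), mul_comm, ← smul_eq_mul, ← sum_const]
    refine sum_congr rfl fun γ hγ => ?_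
    rw [← (mem_filter.1 hγ).2]
    congr 1
    ext p
    simp only [colorClass, mem_filter]
    constructor
    · rintro ⟨⟨h1, _⟩, h2⟩; exact ⟨h1, h2⟩
    · rintro ⟨h1, h2⟩; exact ⟨⟨h1, h2 ▸ hγ⟩, h2⟩
  have hsplit : ∑ γ ∈ cols c S, #(coverPairs c S γ) =
      ∑ γ ∈ U, #(coverPairs c S γ) + ∑ γ ∈ W, #(coverPairs c S γ) :=
    (sum_filter_add_sum_filter_not _ _ _).symm
  have hUle : ∑ γ ∈ U, #(coverPairs c S γ) ≤ #U * (4 * #S - 6) := by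
    rw [← smul_eq_mul]
    refine sum_le_card_nsmul _ _ _ fun γ hγ => ?_
    have := card_coverPairs_le (c := c) γ (mem_filter.1 hγ).1
    omega
  have hWle : ∑ γ ∈ W, #(coverPairs c S γ) ≤ #W * (2 * #S) := by
    rw [← smul_eq_mul]
    exact sum_le_card_nsmul _ _ _ fun γ hγ =>
      card_coverPairs_le_of_ne_two h.symm (by omega) (mem_filter.1 hγ).1 (mem_filter.1 hγ).2
  rw [hcount, hsplit] at hlow
  have hcc := sum_card_colorClass (c := c) (S := S)
  have hs2 : ∑ γ ∈ cols c S, #(colorClass c S γ) =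
      ∑ γ ∈ U, #(colorClass c S γ) + ∑ γ ∈ W, #(colorClass c S γ) :=
    (sum_filter_add_sum_filter_not _ _ _).symm
  have hs3 : ∑ γ ∈ U, #(colorClass c S γ) = #U * 2 := by
    rw [← smul_eq_mul, ← sum_const]
    exact sum_congr rfl fun γ hγ => (mem_filter.1 hγ).2
  have hW1 : ∀ γ, #S = 7 → ∑ δ ∈ W, #(colorClass c S δ) = #(colorClass c S γ) →
      #(colorClass c S γ) ≤ 22 ∨ coverPairs c S γ = ∅ := by
    intro γ h7 _
    by_contra! hne
    have := card_colorClass_le hne.2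
    omega
  generalize hS : #S = n at *
  rcases Nat.lt_or_ge 7 n with h8 | h7
  · obtain ⟨m, rfl⟩ := Nat.exists_eq_add_of_le h8
    have e : (Nat.succ 7 + m) * (Nat.succ 7 + m) - (Nat.succ 7 + m) = m * m + 15 * m + 56 := by
      have : (Nat.succ 7 + m) * (Nat.succ 7 + m) = m * m + 16 * m + 64 := by
        rw [Nat.succ_eq_add_one]; ring
      omega
    rw [e, show Nat.succ 7 + m - 4 = m + 4 by omega] at hlow
    rw [show 4 * (Nat.succ 7 + m) - 6 = 4 * m + 26 by omega] at hUle
    rw [Nat.succ_eq_add_one] at *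
    nlinarith
  · obtain rfl : n = 7 := by omega
    have : Nat.choose 4 2 = 6 := rfl
    norm_num at hlow hcc hUle hWle hr
    rw [this] at hr
    have hW1' : #W ≤ 1 := by omega
    rcases Nat.le_one_iff_eq_zero_or_eq_one.1 hW1' with h0 | h1
    · rw [card_eq_zero.1 h0] at hs2
      simp at hs2; omega
    · obtain ⟨γ, hγ⟩ := card_eq_one.1 h1
      rw [hγ, sum_singleton] at hs2 hlow hW1
      rcases hW1 γ rfl (sum_singleton _ _) with h | h
      · omega
      · rw [h, card_empty] at hlow
        omega

end Bad

section ClaimA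

open Finset Classical

variable {V : Type*} {c : V → V → ℕ} {S : Finset V}

/-- The vertices that together with `z` meet all edges of colour `γ`. -/
noncomputable def coverVerts (c : V → V → ℕ) (S : Finset V) (z : V) (γ : ℕ) : Finset V :=
  {x ∈ S \ {z} | γ ∉ cols c (S \ {z, x})}

theorem coverVerts_subset {z a b : V} (ha : a ∈ S \ {z}) (hb : b ∈ S \ {z}) (hab : a ≠ b) :
    coverVerts c S z (c a b) ⊆ {a, b} := by
  intro x hx
  simp only [coverVerts, mem_filter, notMem_cols_sdiff] at hx
  have := hx.2 a (mem_sdiff.1 ha).1 b (mem_sdiff.1 hb).1 hab rfl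
  simp at ha hb ⊢
  grind

theorem card_coverVerts_le_two {z : V} {γ : ℕ} (h : γ ∈ cols c (S \ {z})) :
    #(coverVerts c S z γ) ≤ 2 := by
  obtain ⟨a, ha, b, hb, hab, rfl⟩ := mem_cols.1 h
  exact (card_le_card (coverVerts_subset ha hb hab)).trans card_le_two

theorem card_coverVerts_le_one {z : V} {γ : ℕ} (hc : ∀ a b, c a b = c b a)
    (h2 : 2 < #(colorClass c (S \ {z}) γ)) : #(coverVerts c S z γ) ≤ 1 := by
  obtain ⟨⟨a, b⟩, hp⟩ := card_pos.1 (by omega : 0 < #(colorClass c (S \ {z}) γ))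
  simp only [colorClass, mem_filter, mem_offDiag] at hp
  obtain ⟨⟨ha, hb, hab⟩, rfl⟩ := hp
  have hsub := colorClass_pair hc ha hb hab
  have hne : {(a, b), (b, a)} ≠ colorClass c (S \ {z}) (c a b) := by
    intro h; rw [← h, card_pair (by simp [hab])] at h2; omega
  obtain ⟨⟨x, y⟩, hp, hp'⟩ := exists_of_ssubset (hsub.ssubset_of_ne hne)
  simp only [colorClass, mem_filter, mem_offDiag] at hp
  obtain ⟨⟨hx, hy, hxy⟩, hcol⟩ := hp
  have h1 := coverVerts_subset (c := c) ha hb hab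
  have h2 := coverVerts_subset (c := c) hx hy hxy
  rw [hcol] at h2
  rw [card_le_one]
  intro p hp q hq
  have := h1 hp; have := h1 hq; have := h2 hp; have := h2 hq
  simp at *
  grind

theorem Bad.exists_isolates_of_isolates (h : Bad c S) {u v z : V} (hI : Isolates c S u v z) :
    ∃ x z', Isolates c S z x z' := by
  by_contra hno
  push Not at hno
  have hn := h.seven_le
  have hident := choose_sub_three_ident (by omega : 3 ≤ #S)
  have hr := h.card_cols
  have huvS := cols_mono sdiff_subset (hI.mem_cols (by omega))
  obtain ⟨⟨hu, hv, hz⟩, ⟨huv, hzu, hzv⟩, hI⟩ := hI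
  have hX := card_sdiff_singleton' hz
  set X := S \ {z} with hXdef
  have hXS : cols c X ⊆ cols c S := cols_mono sdiff_subset
  set Y := cols c S \ cols c X with hY
  have hYX : #Y + #(cols c X) = #(cols c S) := card_sdiff_add_card_eq_card hXS
  have huX : u ∈ X := by simp [*, hzu.symm]
  have hvX : v ∈ X := by simp [*, hzv.symm]
  have hYz : ∀ γ ∈ Y, ∃ x ∈ X, c z x = γ := by
    intro γ hγ
    obtain ⟨hγ, hγX⟩ := mem_sdiff.1 hγ
    obtain ⟨a, ha, b, hb, hab, rfl⟩ := mem_cols.1 hγ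
    by_cases haz : a = z
    · exact ⟨b, by simp [hXdef, hb]; grind, by rw [haz]⟩
    by_cases hbz : b = z
    · exact ⟨a, by simp [hXdef, ha, haz], by rw [hbz, h.symm]⟩
    · exact absurd (mem_cols_of (by simp [*]) (by simp [*]) hab) hγX
  have hYle : #Y ≤ 2 := by
    refine (card_le_card (t := {c z u, c z v}) fun γ hγ => ?_).trans card_le_two
    obtain ⟨x, hx, rfl⟩ := hYz γ hγ
    have hxS := (mem_sdiff.1 hx).1
    have hxz : x ≠ z := by simpa using (mem_sdiff.1 hx).2
    by_cases h1 : x = u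
    · simp [h1]
    by_cases h2 : x = v
    · simp [h2]
    have := hI x hxS h1 h2 hxz
    rw [this] at hγ
    exact absurd (mem_cols_of huX hvX huv) (mem_sdiff.1 hγ).2
  have hlow : ∑ x ∈ X, ((#S - 4) + if c z x ∈ Y then #S - 4 else 0) ≤
      ∑ x ∈ X, #(lost c S z x) := by
    refine sum_le_sum fun x hx => ?_
    have hxS := (mem_sdiff.1 hx).1
    have hxz : x ≠ z := by simpa using (mem_sdiff.1 hx).2
    split_ifs with hxY
    · have := h.priv z hz x hxS hxz.symm (fun hm =>
        (mem_sdiff.1 hxY).2 (cols_mono (sdiff_subset_sdiff subset_rfl (by simp)) hm))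
      omega
    · have := h.le_lost hz hxS hxz.symm (fun w => hno x w)
      omega
  have hYx : #Y ≤ #{x ∈ X | c z x ∈ Y} := by
    refine (card_le_card (t := image (fun x => c z x) {x ∈ X | c z x ∈ Y}) fun γ hγ => ?_).trans
      card_image_le
    obtain ⟨x, hx, rfl⟩ := hYz γ hγ
    exact mem_image_of_mem _ (mem_filter.2 ⟨hx, hγ⟩)
  have hdc : ∑ x ∈ X, #(lost c S z x) = ∑ γ ∈ cols c S, #(coverVerts c S z γ) :=
    sum_card_bipartiteAbove_eq_sum_card_bipartiteBelow (fun x γ => γ ∉ cols c (S \ {z, x}))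
  rw [← sum_sdiff hXS, ← hY] at hdc
  have hYup : ∑ γ ∈ Y, #(coverVerts c S z γ) ≤ #Y * #X := by
    rw [← smul_eq_mul]
    exact sum_le_card_nsmul _ _ _ fun γ _ => card_filter_le _ _
  have hXup : ∑ γ ∈ cols c X, #(coverVerts c S z γ) ≤ #(cols c X) * 2 := by
    rw [← smul_eq_mul]
    exact sum_le_card_nsmul _ _ _ fun γ hγ => card_coverVerts_le_two hγ
  have hXlt : #S = 7 → #Y = 2 → ∑ γ ∈ cols c X, #(coverVerts c S z γ) < #(cols c X) * 2 := by
    intro h7 hY2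
    rw [← smul_eq_mul, ← sum_const]
    refine sum_lt_sum (fun γ hγ => card_coverVerts_le_two hγ) ?_
    by_contra! hall
    have hcc := sum_card_colorClass (c := c) (S := X)
    have : ∑ γ ∈ cols c X, #(colorClass c X γ) ≤ #(cols c X) * 2 := by
      rw [← smul_eq_mul]
      refine sum_le_card_nsmul _ _ _ fun γ hγ => ?_
      by_contra! h2
      have := card_coverVerts_le_one h.symm h2
      have := hall γ hγ
      omega
    have e6 : #X = 6 := by omega
    rw [e6] at hcc
    rw [h7] at hr
    have : Nat.choose 4 2 = 6 := rfl
    norm_num at hr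
    omega
  rw [sum_add_distrib, sum_const, ← sum_filter, sum_const, smul_eq_mul, smul_eq_mul] at hlow
  have hlow2 := Nat.mul_le_mul_right (#S - 4) hYx
  generalize #S = n at *
  obtain ⟨m, rfl⟩ := Nat.exists_eq_add_of_le hn
  obtain hXm : #X = m + 6 := by omega
  rw [hXm, show 7 + m - 4 = m + 3 by omega] at hlow
  rw [show 7 + m - 4 = m + 3 by omega] at hlow2
  rw [hXm] at hYup
  have hm1 : 2 * (#Y + #(cols c X)) + 7 * (7 + m) = (7 + m) * (7 + m) + 16 := by
    rw [hYX, hr]; omega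
  have key : 2 * m + 2 ≤ #Y := by nlinarith
  obtain rfl : m = 0 := by omega
  have := hXlt rfl (by omega)
  have hY2 : #Y = 2 := by omega
  rw [hY2] at *
  omega

end ClaimA

section Large

open Finset Classical

variable {V : Type*} {c : V → V → ℕ} {S : Finset V}

theorem Isolates.lost_at_subset {u v z z' : V} (hI : Isolates c S u v z)
    (hz' : c z z' ∉ lost c S z z') :
    ∃ T : Finset ℕ, #T ≤ 2 ∧ ∀ y ∈ S, y ≠ z → c z y ∈ lost c S z z' → c z y ∈ T := by
  obtain ⟨⟨hu, hv, hz⟩, ⟨huv, hzu, hzv⟩, hI⟩ := hI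
  by_cases h1 : z' = u
  · refine ⟨{c u v, c z v}, card_le_two, fun y hy hyz hl => ?_⟩
    by_cases e1 : y = u
    · rw [e1, ← h1] at hl; exact absurd hl hz'
    by_cases e2 : y = v
    · simp [e2]
    · simp [hI y hy e1 e2 hyz]
  by_cases h2 : z' = v
  · refine ⟨{c u v, c z u}, card_le_two, fun y hy hyz hl => ?_⟩
    by_cases e2 : y = v
    · rw [e2, ← h2] at hl; exact absurd hl hz'
    by_cases e1 : y = u
    · simp [e1]
    · simp [hI y hy e1 e2 hyz]
  · refine ⟨{c z u, c z v}, card_le_two, fun y hy hyz hl => ?_⟩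
    have h3 := hI y hy
    simp
    by_contra! hne
    have h4 := h3 (by grind) (by grind) hyz
    rw [h4, mem_lost] at hl
    have := hl.2 u hu v hv huv rfl
    grind

theorem Isolates.colors_at_subset {u v z : V} (hI : Isolates c S u v z) :
    ∃ T : Finset ℕ, #T ≤ 3 ∧ ∀ y ∈ S, y ≠ z → c z y ∈ T := by
  obtain ⟨⟨hu, hv, hz⟩, ⟨huv, hzu, hzv⟩, hI⟩ := hI
  refine ⟨{c u v, c z u, c z v}, card_le_three, fun y hy hyz => ?_⟩
  by_cases e1 : y = u
  · simp [e1]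
  by_cases e2 : y = v
  · simp [e2]
  · simp [hI y hy e1 e2 hyz]

theorem Bad.exists_isolates_pair (h : Bad c S) (hn : 9 ≤ #S) {u v z u' v' z' : V}
    (hI : Isolates c S u v z) (hI' : Isolates c S u' v' z') (hzz : z ≠ z') :
    ∃ w, Isolates c S z z' w := by
  by_contra! hno
  have hz := hI.1.2.2
  have hz' := hI'.1.2.2
  have key : ∀ T T' : Finset ℕ, (∀ y ∈ S, y ≠ z → c z y ∈ lost c S z z' → c z y ∈ T) →
      (∀ y ∈ S, y ≠ z' → c z' y ∈ lost c S z z' → c z' y ∈ T') →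
      #(lost c S z z') ≤ #T + #T' := by
    intro T T' hT hT'
    refine (card_le_card fun γ hγ => ?_).trans (card_union_le T T')
    have hl := hγ
    obtain ⟨hγ, hl'⟩ := mem_lost.1 hγ
    obtain ⟨a, ha, b, hb, hab, rfl⟩ := mem_cols.1 hγ
    rw [mem_union]
    rcases hl' a ha b hb hab rfl with rfl | rfl | rfl | rfl
    · exact .inl (hT b hb hab.symm hl)
    · exact .inr (hT' b hb hab.symm hl)
    · rw [h.symm] at hl ⊢
      exact .inl (hT a ha hab hl)
    · rw [h.symm] at hl ⊢
      exact .inr (hT' a ha hab hl)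
  by_cases hp : c z z' ∈ cols c (S \ {z, z'})
  · have hn1 := h.nonpriv z hz z' hz' hzz hp hno
    have hnl : c z z' ∉ lost c S z z' := by simp [lost, hp]
    obtain ⟨T, hT2, hT⟩ := hI.lost_at_subset hnl
    obtain ⟨T', hT2', hT'⟩ := hI'.lost_at_subset (z' := z) (by rwa [h.symm, lost_comm])
    rw [lost_comm] at hT'
    have := key T T' hT hT'
    omega
  · have hn1 := h.priv z hz z' hz' hzz hp
    obtain ⟨T, hT2, hT⟩ := hI.colors_at_subset
    obtain ⟨T', hT2', hT'⟩ := hI'.colors_at_subset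
    have := key T T' (fun y hy h _ => hT y hy h) (fun y hy h _ => hT' y hy h)
    omega

/-- The colours of the edges whose removal isolates a vertex. -/
noncomputable def heavyColors (c : V → V → ℕ) (S : Finset V) : Finset ℕ :=
  {γ ∈ cols c S | ∃ a b z, Isolates c S a b z ∧ c a b = γ}

theorem Isolates.mem_heavyColors {u v z : V} (h : Isolates c S u v z) :
    c u v ∈ heavyColors c S :=
  mem_filter.2 ⟨mem_cols_of h.1.1 h.1.2.1 h.2.1.1, u, v, z, h, rfl⟩

theorem Isolates.le_card_colorClass (hc : ∀ a b, c a b = c b a) {u v z : V}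
    (h : Isolates c S u v z) : 2 * #S ≤ #(colorClass c S (c u v)) + 4 := by
  obtain ⟨⟨hu, hv, hz⟩, ⟨huv, hzu, hzv⟩, h⟩ := h
  have h3 := card_sdiff_triple' hu hv hz huv hzv.symm hzu.symm
  have hsub : ({z} ×ˢ (S \ {u, v, z}) ∪ (S \ {u, v, z}) ×ˢ {z}) ∪ {(u, v), (v, u)} ⊆
      colorClass c S (c u v) := by
    intro p hp
    obtain ⟨p1, p2⟩ := p
    simp [colorClass] at hp ⊢
    grind
  have := card_le_card hsub
  rw [card_union_of_disjoint, card_union_of_disjoint, card_product, card_product, card_singleton,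
    card_pair (by simp [huv])] at this
  · omega
  · rw [Finset.disjoint_left]
    rintro ⟨p1, p2⟩ hp
    simp at hp ⊢
    grind
  · rw [Finset.disjoint_left]
    rintro ⟨p1, p2⟩ hp
    simp at hp ⊢
    grind

theorem Bad.card_heavyColors (h : Bad c S) : #(heavyColors c S) ≤ 3 := by
  have hn := h.seven_le
  have hident := choose_sub_three_ident (by omega : 3 ≤ #S)
  have hr := h.card_cols
  have hcc := sum_card_colorClass (c := c) (S := S)
  have hQ : heavyColors c S ⊆ cols c S := filter_subset _ _
  have hle : ∑ γ ∈ cols c S, (2 + if γ ∈ heavyColors c S then 2 * #S - 6 else 0) ≤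
      ∑ γ ∈ cols c S, #(colorClass c S γ) := by
    refine sum_le_sum fun γ hγ => ?_
    split_ifs with hγQ
    · obtain ⟨_, a, b, z, hI, rfl⟩ := mem_filter.1 hγQ
      have := hI.le_card_colorClass h.symm
      omega
    · obtain ⟨a, ha, b, hb, hab, rfl⟩ := mem_cols.1 hγ
      have := card_le_card (colorClass_pair h.symm ha hb hab)
      rw [card_pair (by simp [hab])] at this
      omega
  rw [hcc, sum_add_distrib, sum_const, ← sum_filter, sum_const, filter_mem_eq_inter,
    inter_eq_right.2 hQ, smul_eq_mul, smul_eq_mul] at hle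
  generalize #S = n at *
  by_contra! h4
  have := Nat.mul_le_mul_right (2 * n - 6) h4
  omega

/-- All heavy colours are concentrated around three vertices. -/
theorem Bad.exists_triple (h : Bad c S) (hn : 9 ≤ #S) : ∃ J ⊆ S, #J = 3 ∧
    (∀ a ∈ S, ∀ b ∈ S, a ≠ b → c a b ∉ heavyColors c S → a ∈ S \ J ∧ b ∈ S \ J) ∧
    ∀ w ∈ J, ∀ y ∈ S \ J, ∀ y' ∈ S \ J, c w y = c w y' := by
  obtain ⟨u0, v0, h0, hh0⟩ := h.exists_isolates
  obtain ⟨x, h1, hh1⟩ := h.exists_isolates_of_isolates hh0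
  have hne01 := hh1.2.1.2.1
  obtain ⟨w1, hw1⟩ := h.exists_isolates_pair hn hh0 hh1 hne01.symm
  obtain ⟨w2, hw2⟩ := h.exists_isolates_pair hn hw1 hh1 hw1.2.1.2.2
  obtain ⟨w3, hw3⟩ := h.exists_isolates_pair hn hw1 hw2 hw2.2.1.2.1.symm
  set Q := heavyColors c S with hQdef
  have hQ3 : #Q ≤ 3 := h.card_heavyColors
  have hpair : ∀ {u v z u' v' z' : V}, Isolates c S u v z → Isolates c S u' v' z' → z ≠ z' →
      c z z' ∈ Q := by
    intro u v z u' v' z' h1 h2 h3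
    obtain ⟨w, hw⟩ := h.exists_isolates_pair hn h1 h2 h3
    exact hw.mem_heavyColors
  have hQof : ∀ {a b z}, Isolates c S a b z → ∀ y ∈ S, y ≠ z → y ≠ a → y ≠ b → c z y ∈ Q := by
    intro a b z hI y hy h1 h2 h3
    rw [hI.2.2 y hy h2 h3 h1]
    exact hI.mem_heavyColors
  have hq1 : ∀ y ∈ S, y ≠ w1 → c w1 y ∈ Q := by
    intro y hy hyw
    by_cases e1 : y = h0
    · subst e1; exact hpair hw1 hh0 hyw.symm
    by_cases e2 : y = h1
    · subst e2; exact hpair hw1 hh1 hyw.symm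
    exact hQof hw1 y hy hyw e1 e2
  have hq2 : ∀ y ∈ S, y ≠ w2 → c w2 y ∈ Q := by
    intro y hy hyw
    by_cases e1 : y = w1
    · subst e1; exact hpair hw2 hw1 hyw.symm
    by_cases e2 : y = h1
    · subst e2; exact hpair hw2 hh1 hyw.symm
    exact hQof hw2 y hy hyw e1 e2
  have hq3 : ∀ y ∈ S, y ≠ w3 → c w3 y ∈ Q := by
    intro y hy hyw
    by_cases e1 : y = w1
    · subst e1; exact hpair hw3 hw1 hyw.symm
    by_cases e2 : y = w2
    · subst e2; exact hpair hw3 hw2 hyw.symm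
    exact hQof hw3 y hy hyw e1 e2
  have hw1S := hw1.1.2.2
  have hw2S := hw2.1.2.2
  have hw3S := hw3.1.2.2
  have hn12 : w1 ≠ w2 := hw2.2.1.2.1.symm
  have hn13 : w1 ≠ w3 := hw3.2.1.2.1.symm
  have hn23 : w2 ≠ w3 := hw3.2.1.2.2.symm
  set X := S \ {w1, w2, w3} with hX
  have hXc : #X + 3 = #S := card_sdiff_triple' hw1S hw2S hw3S hn12 hn23 hn13
  have hout : ∀ a ∈ S, ∀ b ∈ S, a ≠ b → c a b ∉ Q → a ∈ X ∧ b ∈ X := by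
    intro a ha b hb hab hnQ
    have hnQ' : c b a ∉ Q := by rwa [h.symm]
    simp only [hX, mem_sdiff, mem_insert, mem_singleton]
    refine ⟨⟨ha, ?_⟩, ⟨hb, ?_⟩⟩
    · rintro (rfl | rfl | rfl)
      exacts [hnQ (hq1 b hb hab.symm), hnQ (hq2 b hb hab.symm), hnQ (hq3 b hb hab.symm)]
    · rintro (rfl | rfl | rfl)
      exacts [hnQ' (hq1 a ha hab), hnQ' (hq2 a ha hab), hnQ' (hq3 a ha hab)]
  have hident := choose_sub_three_ident (by omega : 3 ≤ #S)
  have hr := h.card_cols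
  have hheavy : ∀ a b z, Isolates c S a b z → z ∉ X := by
    intro a b z hI hz
    have hsub : cols c S ⊆ (Q ∪ {c z a, c z b}) ∪ cols c (X \ {z}) := by
      intro γ hγ
      obtain ⟨p, hp, q, hq, hpq, rfl⟩ := mem_cols.1 hγ
      by_cases hpqQ : c p q ∈ Q
      · simp [hpqQ]
      obtain ⟨hpX, hqX⟩ := hout p hp q hq hpq hpqQ
      by_cases hpz : p = z
      · subst hpz
        have := hQof hI q hq hpq.symm
        have hab : q = a ∨ q = b := by tauto
        rcases hab with rfl | rfl <;> simp
      by_cases hqz : q = z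
      · subst hqz
        have := hQof hI p hp hpq
        rw [h.symm p q] at hpqQ ⊢
        have hab : p = a ∨ p = b := by tauto
        rcases hab with rfl | rfl <;> simp
      · exact mem_union_right _ (mem_cols_of (by simp [hpX, hpz]) (by simp [hqX, hqz]) hpq)
    have h1 := (card_le_card hsub).trans ((card_union_le _ _).trans
      (Nat.add_le_add_right ((card_union_le _ _).trans
        (Nat.add_le_add_left card_le_two _)) _))
    have h2 := card_sdiff_singleton' hz
    have h3 := sum_card_colorClass (c := c) (S := X \ {z})
    have h4 : #(cols c (X \ {z})) * 2 ≤ ∑ γ ∈ cols c (X \ {z}), #(colorClass c (X \ {z}) γ) := by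
      rw [← smul_eq_mul]
      refine card_nsmul_le_sum _ _ _ fun γ hγ => ?_
      obtain ⟨a, ha, b, hb, hab, rfl⟩ := mem_cols.1 hγ
      have := card_le_card (colorClass_pair h.symm ha hb hab)
      rwa [card_pair (by simp [hab])] at this
    rw [h3] at h4
    obtain ⟨m, hm⟩ := Nat.exists_eq_add_of_le hn
    rw [show #(X \ {z}) = m + 5 by omega] at h4
    rw [hm] at hident
    have e : (m + 5) * (m + 5) = m * m + 10 * m + 25 := by ring
    have e' : (9 + m) * (9 + m) = m * m + 18 * m + 81 := by ring
    rw [hm] at hr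
    omega
  have hJ : ∀ {a b z}, Isolates c S a b z → z = w1 ∨ z = w2 ∨ z = w3 := by
    intro a b z hI
    have := hheavy a b z hI
    have hzS := hI.1.2.2
    simp [hX, hzS] at this
    tauto
  have hJ0 := hJ hh0
  have hJ1 := hJ hh1
  have hconst : ∀ w ∈ ({w1, w2, w3} : Finset V), ∀ y ∈ X, ∀ y' ∈ X, c w y = c w y' := by
    have aux : ∀ {a b z}, Isolates c S a b z → (a = w1 ∨ a = w2 ∨ a = w3) →
        (b = w1 ∨ b = w2 ∨ b = w3) → (z = w1 ∨ z = w2 ∨ z = w3) →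
        ∀ y ∈ X, ∀ y' ∈ X, c z y = c z y' := by
      intro a b z hI ha hb hz y hy y' hy'
      simp only [hX, mem_sdiff, mem_insert, mem_singleton] at hy hy'
      rw [hI.2.2 y hy.1 (by grind) (by grind) (by grind),
        hI.2.2 y' hy'.1 (by grind) (by grind) (by grind)]
    intro w hw
    simp only [mem_insert, mem_singleton] at hw
    rcases hw with rfl | rfl | rfl
    · exact aux hw1 hJ0 hJ1 (by simp)
    · exact aux hw2 (by simp) hJ1 (by simp)
    · exact aux hw3 (by simp) (by simp) (by simp)
  refine ⟨{w1, w2, w3}, ?_, card_eq_three.2 ⟨w1, w2, w3, hn12, hn13, hn23, rfl⟩, hout, hconst⟩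
  simp [insert_subset_iff, *]

theorem Bad.false_of_nine_le (h : Bad c S) (hn : 9 ≤ #S) : False := by
  obtain ⟨J, hJS, hJ3, hout, hconst⟩ := h.exists_triple hn
  have hident := choose_sub_three_ident (by omega : 3 ≤ #S)
  have hr := h.card_cols
  set Q := heavyColors c S with hQdef
  have hQ3 : #Q ≤ 3 := h.card_heavyColors
  set X := S \ J with hX
  have hXc : #X + 3 = #S := by
    have := card_sdiff_add_card_eq_card hJS
    rwa [← hX, hJ3] at this
  have hXQ : #(cols c S) ≤ #(cols c X \ Q) + 3 := by
    have hsub : cols c S ⊆ (cols c X \ Q) ∪ Q := by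
      intro γ hγ
      obtain ⟨p, hp, q, hq, hpq, rfl⟩ := mem_cols.1 hγ
      by_cases hpqQ : c p q ∈ Q
      · simp [hpqQ]
      obtain ⟨hpX, hqX⟩ := hout p hp q hq hpq hpqQ
      exact mem_union_left _ (mem_sdiff.2 ⟨mem_cols_of hpX hqX hpq, hpqQ⟩)
    exact (card_le_card hsub).trans ((card_union_le _ _).trans (by omega))
  obtain ⟨γ, hγ, hγ3⟩ : ∃ γ ∈ cols c X \ Q, #(colorClass c X γ) < 3 := by
    by_contra! hall
    have h3 := sum_card_colorClass (c := c) (S := X)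
    have h4 := card_nsmul_le_sum _ _ _ hall
    have h5 := sum_le_sum_of_subset (f := fun γ => #(colorClass c X γ))
      (sdiff_subset : cols c X \ Q ⊆ cols c X)
    rw [smul_eq_mul] at h4
    obtain ⟨m, hm⟩ := Nat.exists_eq_add_of_le hn
    rw [show #X = m + 6 by omega] at h3
    rw [hm] at hident hr
    have e : (m + 6) * (m + 6) = m * m + 12 * m + 36 := by ring
    have e' : (9 + m) * (9 + m) = m * m + 18 * m + 81 := by ring
    have : 0 ≤ m * m := Nat.zero_le _
    omega
  obtain ⟨hγX, hγQ⟩ := mem_sdiff.1 hγ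
  obtain ⟨a, ha, b, hb, hab, rfl⟩ := mem_cols.1 hγX
  have haS := (mem_sdiff.1 ha).1
  have hbS := (mem_sdiff.1 hb).1
  have heq := eq_of_subset_of_card_le (colorClass_pair h.symm ha hb hab) (by
    rw [card_pair (by simp [hab])]; omega)
  have hpriv := h.priv a haS b hbS hab (by
    rw [notMem_cols_sdiff]
    intro p hp q hq hpq hcpq
    obtain ⟨hpX, hqX⟩ := hout p hp q hq hpq (by rwa [hcpq])
    have : (p, q) ∈ colorClass c X (c a b) := mem_filter.2 ⟨mem_offDiag.2 ⟨hpX, hqX, hpq⟩, hcpq⟩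
    rw [← heq] at this
    simp at this
    tauto)
  have hlost : lost c S a b ⊆ {c a b} ∪ (image (c a) (X \ {a, b}) ∪ image (c b) (X \ {a, b})) := by
    have hX2 := card_sdiff_pair' ha hb hab
    obtain ⟨y, hy⟩ := card_pos.1 (by omega : 0 < #(X \ {a, b}))
    simp only [mem_sdiff, mem_insert, mem_singleton] at hy
    have hyS := (mem_sdiff.1 hy.1).1
    have hyJ := (mem_sdiff.1 hy.1).2
    have key : ∀ s ∈ X, (s = a ∨ s = b) → ∀ t ∈ S, s ≠ t → c s t ∈ lost c S a b → c s t ∈ ({c a b} ∪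
        (image (c a) (X \ {a, b}) ∪ image (c b) (X \ {a, b})) : Finset ℕ) := by
      intro s hsX hs t ht hst hl
      have htX : t ∈ X := by
        by_contra htX
        have htJ : t ∈ J := by simpa [hX, ht] using htX
        have hty : t ≠ y := by rintro rfl; exact htX hy.1
        have hcc : c t y = c s t := by rw [h.symm s t]; exact hconst t htJ y hy.1 s hsX
        have hmem := (mem_lost.1 hl).2 t ht y hyS hty hcc
        have hta : t ≠ a := by rintro rfl; exact htX ha
        have htb : t ≠ b := by rintro rfl; exact htX hb
        tauto
      by_cases hta : t = a
      · have hsb : s = b := by grind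
        rw [hta, hsb, h.symm b a]
        simp
      by_cases htb : t = b
      · have hsa : s = a := by grind
        rw [htb, hsa]
        simp
      have ht' : t ∈ X \ {a, b} := by simp [htX, hta, htb]
      rcases hs with rfl | rfl
      · exact mem_union_right _ (mem_union_left _ (mem_image_of_mem _ ht'))
      · exact mem_union_right _ (mem_union_right _ (mem_image_of_mem _ ht'))
    intro γ hγ
    have hl := hγ
    obtain ⟨hγ, hl'⟩ := mem_lost.1 hγ
    obtain ⟨p, hp, q, hq, hpq, rfl⟩ := mem_cols.1 hγ
    rcases hl' p hp q hq hpq rfl with e | e | e | e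
    · exact key p (e ▸ ha) (.inl e) q hq hpq hl
    · exact key p (e ▸ hb) (.inr e) q hq hpq hl
    · rw [h.symm p q] at hl ⊢
      exact key q (e ▸ ha) (.inl e) p hp hpq.symm hl
    · rw [h.symm p q] at hl ⊢
      exact key q (e ▸ hb) (.inr e) p hp hpq.symm hl
  have h1 := (card_le_card hlost).trans ((card_union_le _ _).trans
    (Nat.add_le_add_left
      ((card_union_le _ _).trans (Nat.add_le_add card_image_le card_image_le)) _))
  have hX2 := card_sdiff_pair' ha hb hab
  rw [card_singleton] at h1
  omega

end Large

section Search

open Finset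

/-- Apply `k` to `n`, in a form whose evaluation starts with that of `n`. -/
def force {α : Type*} (n : ℕ) (k : ℕ → α) : α :=
  Nat.rec (k 0) (fun m _ => k m.succ) n

@[simp] theorem force_eq {α : Type*} (n : ℕ) (k : ℕ → α) : force n k = k n := by
  cases n <;> rfl

/-- The byte of `st` that starts at bit `s`. -/
def byteAt (st s : ℕ) : ℕ := Nat.land (Nat.shiftRight st s) 255

/-- Bitwise union and sum of the bytes of `st` at the given positions. -/
def orBytes (st : ℕ) (l : List ℕ) : ℕ := List.rec 0 (fun s _ ih => Nat.lor (byteAt st s) ih) l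

/-- Sum of the bytes of `st` at the given positions. -/
def sumBytes (st : ℕ) (l : List ℕ) : ℕ := List.rec 0 (fun s _ ih => Nat.add (byteAt st s) ih) l

/-- Remove from `V` the colours that complete a rainbow constraint. -/
def viable (st : ℕ) (ts : List (List ℕ)) : ℕ → ℕ :=
  List.rec (fun V => V) (fun l _ ih V =>
    force (orBytes st l) fun m =>
      bif Nat.beq m (sumBytes st l) then
        force (Nat.land V m) fun V' => bif Nat.beq V' 0 then 0 else ih V'
      else ih V) ts

/-- Replace the byte 255 of `st` at `e` by `2 ^ i`, and scramble the lowest 64 bits of `st`, which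
only serve to give different states different hash values. -/
def assign (st e i : ℕ) : ℕ :=
  Nat.xor (Nat.xor st (Nat.shiftLeft (i + 1) (e % 61))) (Nat.shiftLeft (255 - 2 ^ i) e)

/-- Does every extension of the partial colouring `st` with `k` colours to the entries of `rest`
either complete a rainbow constraint or use fewer than `r` colours? -/
def search (r : ℕ) (rest : List (ℕ × List (List ℕ))) : ℕ → ℕ → Bool :=
  List.rec (fun _ k => Nat.blt k r) (fun x xs ih st k =>
    bif Nat.blt (k + (xs.length + 1)) r then true else
      force (viable st x.2 (2 ^ (min (k + 1) r) - 1)) fun V =>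
        (List.range 8).all fun i => bif Nat.testBit V i then
          force (assign st x.1 i) fun st' =>
            force (bif Nat.beq i k then k + 1 else k) fun k' => ih st' k'
        else true) rest

theorem testBit_byteAt (st s i : ℕ) :
    (byteAt st s).testBit i = (st.testBit (s + i) && decide (i < 8)) := by
  change ((st >>> s) &&& 255).testBit i = _
  rw [show 255 = 2 ^ 8 - 1 by rfl, Nat.testBit_and, Nat.testBit_shiftRight,
    Nat.testBit_two_pow_sub_one]

theorem byteAt_update_self {st e i : ℕ} (hi : i < 8) (h : byteAt st e = 255) :
    byteAt (Nat.xor st (Nat.shiftLeft (255 - 2 ^ i) e)) e = 2 ^ i := by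
  have : byteAt (Nat.xor st (Nat.shiftLeft (255 - 2 ^ i) e)) e =
      byteAt st e ^^^ ((255 - 2 ^ i) &&& 255) := by
    apply Nat.eq_of_testBit_eq
    intro j
    change (byteAt (st ^^^ ((255 - 2 ^ i) <<< e)) e).testBit j = _
    rw [Nat.testBit_xor, testBit_byteAt, testBit_byteAt, Nat.testBit_xor, Nat.testBit_shiftLeft,
      Nat.testBit_and, show 255 = 2 ^ 8 - 1 by rfl, Nat.testBit_two_pow_sub_one]
    by_cases hj : j < 8 <;> simp [hj]
  rw [this, h]
  interval_cases i <;> rfl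

theorem byteAt_update_ne {st e s i : ℕ} (he : 8 ∣ e) (hs : 8 ∣ s) (hne : s ≠ e) :
    byteAt (Nat.xor st (Nat.shiftLeft (255 - 2 ^ i) e)) s = byteAt st s := by
  apply Nat.eq_of_testBit_eq
  intro j
  change (byteAt (st ^^^ ((255 - 2 ^ i) <<< e)) s).testBit j = _
  rw [testBit_byteAt, testBit_byteAt, Nat.testBit_xor, Nat.testBit_shiftLeft]
  by_cases hj : j < 8
  · by_cases hge : e ≤ s + j
    · have : (255 - 2 ^ i).testBit (s + j - e) = false := by
        apply Nat.testBit_lt_two_pow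
        have h8 : 8 ≤ s + j - e := by omega
        calc 255 - 2 ^ i < 2 ^ 8 := (Nat.sub_le _ _).trans_lt (by norm_num)
          _ ≤ _ := Nat.pow_le_pow_right (by norm_num) h8
      simp [this]
    · simp [show ¬ (s + j ≥ e) from hge]
  · simp [hj]

theorem byteAt_scramble {st e s i : ℕ} (hi : i < 8) (hs : 64 ≤ s) :
    byteAt (Nat.xor st (Nat.shiftLeft (i + 1) (e % 61))) s = byteAt st s := by
  apply Nat.eq_of_testBit_eq
  intro j
  change (byteAt (st ^^^ ((i + 1) <<< (e % 61))) s).testBit j = _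
  rw [testBit_byteAt, testBit_byteAt, Nat.testBit_xor, Nat.testBit_shiftLeft]
  have : (i + 1).testBit (s + j - e % 61) = false := by
    apply Nat.testBit_lt_two_pow
    have h4 : 4 ≤ s + j - e % 61 := by omega
    calc i + 1 < 2 ^ 4 := by omega
      _ ≤ _ := Nat.pow_le_pow_right (by norm_num) h4
  simp [this]

theorem byteAt_assign_self {st e i : ℕ} (hi : i < 8) (he : 64 ≤ e) (h : byteAt st e = 255) :
    byteAt (assign st e i) e = 2 ^ i :=
  byteAt_update_self hi ((byteAt_scramble hi he).trans h)

theorem byteAt_assign_ne {st e s i : ℕ} (hi : i < 8) (he : 8 ∣ e) (hs : 8 ∣ s) (hs' : 64 ≤ s)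
    (hne : s ≠ e) : byteAt (assign st e i) s = byteAt st s :=
  (byteAt_update_ne he hs hne).trans (byteAt_scramble hi hs')

theorem orBytes_cons (st s : ℕ) (l : List ℕ) :
    orBytes st (s :: l) = byteAt st s ||| orBytes st l := rfl

theorem sumBytes_cons (st s : ℕ) (l : List ℕ) :
    sumBytes st (s :: l) = byteAt st s + sumBytes st l := rfl

theorem testBit_orBytes {st i : ℕ} {l : List ℕ} {s : ℕ} (hs : s ∈ l)
    (h : (byteAt st s).testBit i) : (orBytes st l).testBit i := by
  induction l with
  | nil => simp at hs
  | cons a l ih =>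
    rw [orBytes_cons, Nat.testBit_or]
    rcases List.mem_cons.1 hs with rfl | hs
    · simp [h]
    · simp [ih hs]

theorem lor_le_add (a b : ℕ) : a ||| b ≤ a + b := by
  induction a using Nat.strong_induction_on generalizing b with
  | _ a ih =>
    rcases Nat.eq_zero_or_pos a with rfl | ha
    · simp
    have h1 := ih (a / 2) (by omega) (b / 2)
    rw [← Nat.or_div_two] at h1
    have h2 := Nat.or_mod_two_eq_one (a := a) (b := b)
    omega

theorem orBytes_le_sumBytes (st : ℕ) (l : List ℕ) : orBytes st l ≤ sumBytes st l := by
  induction l with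
  | nil => rfl
  | cons a l ih =>
    rw [orBytes_cons, sumBytes_cons]
    have := lor_le_add (byteAt st a) (orBytes st l)
    omega

theorem pairwise_of_orBytes_eq {st : ℕ} {l : List ℕ} (hpos : ∀ s ∈ l, byteAt st s ≠ 0)
    (h : orBytes st l = sumBytes st l) : l.Pairwise fun a b => byteAt st a ≠ byteAt st b := by
  induction l with
  | nil => exact List.Pairwise.nil
  | cons a l ih =>
    rw [orBytes_cons, sumBytes_cons] at h
    have h1 := lor_le_add (byteAt st a) (orBytes st l)
    have h2 := orBytes_le_sumBytes st l
    refine List.Pairwise.cons (fun b hb hab => ?_)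
      (ih (fun s hs => hpos s (List.mem_cons_of_mem _ hs)) (by omega))
    have h3 : byteAt st a ||| orBytes st l = orBytes st l := by
      apply Nat.eq_of_testBit_eq
      intro i
      rw [Nat.testBit_or]
      cases hi : (byteAt st a).testBit i
      · simp
      · simp [testBit_orBytes hb (hab ▸ hi)]
    have := hpos a (by simp)
    omega

theorem testBit_viable {st i : ℕ} {ts : List (List ℕ)} :
    ∀ {V : ℕ}, V.testBit i → (∀ l ∈ ts, orBytes st l = sumBytes st l → (orBytes st l).testBit i) →
      (viable st ts V).testBit i := by
  induction ts with
  | nil => intro V hV _; exact hV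
  | cons l ts ih =>
    intro V hV h
    change (force (orBytes st l) fun m => bif Nat.beq m (sumBytes st l) then
      force (Nat.land V m) fun V' => bif Nat.beq V' 0 then 0 else viable st ts V'
      else viable st ts V).testBit i
    rw [force_eq, force_eq]
    have h' := fun l hl => h l (List.mem_cons_of_mem _ hl)
    by_cases heq : orBytes st l = sumBytes st l
    · rw [show Nat.beq (orBytes st l) (sumBytes st l) = true from Nat.beq_eq ▸ heq]
      have hbit : (Nat.land V (orBytes st l)).testBit i := by
        change (V &&& orBytes st l).testBit i
        rw [Nat.testBit_and, hV, h l (by simp) heq]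
        rfl
      have hne : Nat.beq (Nat.land V (orBytes st l)) 0 = false := by
        rw [← Bool.not_eq_true, Nat.beq_eq]
        intro h0
        rw [h0, Nat.zero_testBit] at hbit
        cases hbit
      rw [cond_true, hne]
      exact ih hbit h'
    · have : Nat.beq (orBytes st l) (sumBytes st l) = false := by
        rw [← Bool.not_eq_true, Nat.beq_eq]; exact heq
      rw [this]
      exact ih hV h'

theorem search_cons (r : ℕ) (x : ℕ × List (List ℕ)) (xs) (st k : ℕ) :
    search r (x :: xs) st k = true ↔ k + (xs.length + 1) < r ∨
      ∀ i < 8, (viable st x.2 (2 ^ (min (k + 1) r) - 1)).testBit i →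
        search r xs (assign st x.1 i) (if i = k then k + 1 else k) := by
  change (bif Nat.blt (k + (xs.length + 1)) r then true else
      force (viable st x.2 (2 ^ (min (k + 1) r) - 1)) fun V =>
        (List.range 8).all fun i => bif Nat.testBit V i then
          force (assign st x.1 i) fun st' =>
            force (bif Nat.beq i k then k + 1 else k) fun k' => search r xs st' k'
        else true) = true ↔ _
  by_cases hlt : k + (xs.length + 1) < r
  · simp [hlt, Nat.blt_eq]
  · have : Nat.blt (k + (xs.length + 1)) r = false := by
      rw [← Bool.not_eq_true, Nat.blt_eq]; exact hlt
    rw [this]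
    simp only [force_eq, cond_false, List.all_eq_true, List.mem_range, hlt, false_or]
    refine forall₂_congr fun i _ => ?_
    have hb : (bif Nat.beq i k then k + 1 else k) = if i = k then k + 1 else k := by
      by_cases h : i = k
      · simp [h]
      · have : Nat.beq i k = false := by rw [← Bool.not_eq_true, Nat.beq_eq]; exact h
        simp [h, this]
    rw [hb]
    cases Nat.testBit (viable st x.2 (2 ^ (min (k + 1) r) - 1)) i <;> simp

theorem search_sound {P : Prop} {U : Finset ℕ} (hU : ∀ e ∈ U, 8 ∣ e ∧ 64 ≤ e) {χ : ℕ → ℕ} {r : ℕ}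
    (hr : #(U.image χ) = r) (hr8 : r ≤ 8) (rest : List (ℕ × List (List ℕ))) :
    ∀ (E : Finset ℕ) (st : ℕ) (ρ : ℕ → ℕ), (rest.map Prod.fst).Nodup →
      (∀ x ∈ rest, x.1 ∉ E) → (∀ e, e ∈ U ↔ e ∈ E ∨ e ∈ rest.map Prod.fst) →
      (∀ x ∈ rest, ∀ l ∈ x.2, (∀ s ∈ l, s ∈ U) ∧ (((x.1 :: l).map χ).Nodup → P)) →
      (∀ e ∈ E, byteAt st e = 2 ^ ρ (χ e)) → (∀ x ∈ rest, byteAt st x.1 = 255) →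
      Set.InjOn ρ (E.image χ) → (∀ γ ∈ E.image χ, ρ γ < #(E.image χ)) →
      search r rest st #(E.image χ) = true → P := by
  induction rest with
  | nil =>
    intro E st ρ _ _ hUE _ _ _ _ _ hs
    have : E = U := by ext e; simp [hUE]
    subst this
    rw [hr] at hs
    have : r < r := Nat.blt_eq ▸ hs
    omega
  | cons x xs ih =>
    intro E st ρ hnd hxE hUE hval hE h255 hinj hlt hs
    by_contra hP
    rw [search_cons] at hs
    have hEU : E ⊆ U := fun e he => (hUE e).2 (.inl he)
    have hxU : x.1 ∈ U := (hUE _).2 (.inr (by simp))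
    have hkr : #(E.image χ) ≤ r := hr ▸ card_le_card (image_subset_image hEU)
    rcases hs with hs | hs
    · have h1 : U.image χ ⊆ E.image χ ∪ ((x :: xs).map Prod.fst).toFinset.image χ := by
        rw [← image_union]
        refine image_subset_image fun e he => ?_
        have := (hUE e).1 he
        rwa [mem_union, List.mem_toFinset]
      have h2 := (card_le_card h1).trans ((card_union_le _ _).trans (Nat.add_le_add_left
        (card_image_le.trans (List.toFinset_card_le _)) _))
      simp only [List.length_map, List.length_cons] at h2
      omega
    obtain ⟨ρ', hagree, hinj', hlt', hcard', h8⟩ : ∃ ρ' : ℕ → ℕ, (∀ γ ∈ E.image χ, ρ' γ = ρ γ) ∧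
        Set.InjOn ρ' ((insert x.1 E).image χ) ∧
        (∀ γ ∈ (insert x.1 E).image χ, ρ' γ < #((insert x.1 E).image χ)) ∧
        #((insert x.1 E).image χ) = (if ρ' (χ x.1) = #(E.image χ) then #(E.image χ) + 1 else
          #(E.image χ)) ∧ ρ' (χ x.1) < min (#(E.image χ) + 1) r := by
      by_cases hγ : χ x.1 ∈ E.image χ
      · have hlt1 := hlt _ hγ
        rw [image_insert, insert_eq_of_mem hγ]
        exact ⟨ρ, fun _ _ => rfl, hinj, hlt, by rw [if_neg (by omega)], by omega⟩
      · have hnew : #(insert (χ x.1) (E.image χ)) = #(E.image χ) + 1 := card_insert_of_notMem hγ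
        have hle : #(insert (χ x.1) (E.image χ)) ≤ r := by
          rw [← hr, ← image_insert]
          exact card_le_card (image_subset_image (insert_subset hxU hEU))
        have hne : ∀ γ ∈ E.image χ, γ ≠ χ x.1 := by rintro γ h rfl; exact hγ h
        refine ⟨Function.update ρ (χ x.1) #(E.image χ), fun γ h => ?_, ?_, ?_, ?_, ?_⟩
        · rw [Function.update_of_ne (hne γ h)]
        · rw [image_insert, coe_insert]
          rintro a ha b hb hab
          rcases ha with rfl | ha <;> rcases hb with rfl | hb
          · rfl
          · rw [Function.update_self, Function.update_of_ne (hne b hb)] at hab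
            have := hlt b hb
            omega
          · rw [Function.update_self, Function.update_of_ne (hne a ha)] at hab
            have := hlt a ha
            omega
          · rw [Function.update_of_ne (hne b hb), Function.update_of_ne (hne a ha)] at hab
            exact hinj ha hb hab
        · rw [image_insert, hnew]
          intro γ h
          rcases mem_insert.1 h with rfl | h
          · rw [Function.update_self]; omega
          · rw [Function.update_of_ne (hne γ h)]
            have := hlt γ h
            omega
        · rw [image_insert, hnew, Function.update_self, if_pos rfl]
        · rw [Function.update_self]; omega
    have hE' : ∀ e ∈ E, byteAt st e = 2 ^ ρ' (χ e) := fun e he => by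
      rw [hagree _ (mem_image_of_mem _ he), hE e he]
    have hc8 : ρ' (χ x.1) < 8 := by omega
    have hbit := hs _ hc8 (by
      apply testBit_viable
      · rw [Nat.testBit_two_pow_sub_one]; simpa using h8
      · intro l hl hsum
        by_contra hno
        obtain ⟨hlU, hlP⟩ := hval x (by simp) l hl
        have hsE : ∀ s ∈ l, s ∈ E := by
          intro s hs
          by_contra hsE
          obtain ⟨y, hy, rfl⟩ := List.mem_map.1 (((hUE s).1 (hlU s hs)).resolve_left hsE)
          apply hno
          apply testBit_orBytes hs
          rw [h255 y hy, show 255 = 2 ^ 8 - 1 by rfl, Nat.testBit_two_pow_sub_one]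
          simpa using hc8
        refine hP (hlP ?_)
        rw [List.map_cons, List.nodup_cons]
        constructor
        · intro hmem
          obtain ⟨s, hs, hsx⟩ := List.mem_map.1 hmem
          apply hno
          apply testBit_orBytes hs
          rw [hE' s (hsE s hs), hsx, Nat.testBit_two_pow_self]
        · have := pairwise_of_orBytes_eq (fun s hs => by
            rw [hE' s (hsE s hs)]; positivity) hsum
          rw [List.Nodup, List.pairwise_map]
          refine this.imp_of_mem fun {a b} ha hb hab h => hab ?_
          rw [hE' a (hsE a ha), hE' b (hsE b hb), h])
    rw [← hcard'] at hbit
    rw [List.map_cons, List.nodup_cons] at hnd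
    have hxne : ∀ y ∈ xs, y.1 ≠ x.1 := by
      intro y hy h
      exact hnd.1 (List.mem_map.2 ⟨y, hy, h⟩)
    have hEne : ∀ y ∈ E, y ≠ x.1 := by
      rintro y hy rfl
      exact hxE x (by simp) hy
    refine hP (ih (insert x.1 E) _ ρ' hnd.2 ?_ ?_ (fun y hy => hval y (by simp [hy])) ?_ ?_ hinj'
      hlt' hbit)
    · intro y hy h
      rcases mem_insert.1 h with h | h
      · exact hxne y hy h
      · exact hxE y (by simp [hy]) h
    · intro e
      rw [hUE, mem_insert, List.map_cons, List.mem_cons]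
      tauto
    · intro e he
      rcases mem_insert.1 he with rfl | he
      · exact byteAt_assign_self hc8 (hU _ hxU).2 (h255 x (by simp))
      · rw [byteAt_assign_ne hc8 (hU _ hxU).1 (hU _ (hEU he)).1 (hU _ (hEU he)).2 (hEne e he),
          hE' e he]
    · intro y hy
      have hyU := hU y.1 ((hUE _).2 (.inr (List.mem_map.2 ⟨y, by simp [hy], rfl⟩)))
      rw [byteAt_assign_ne hc8 (hU _ hxU).1 hyU.1 hyU.2 (hxne y hy), h255 y (by simp [hy])]

end Search

section SearchData

/-- The bit position at which the colour of `ab` is stored. -/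
def slot (a b : ℕ) : ℕ := bif Nat.blt a b then 56 * (a + 2) + 8 * b else 56 * (b + 2) + 8 * a

/-- The copies of `P₃ ∪ P₂` on the vertices below 5, as a path followed by an edge. -/
def copies₅ : List (List ℕ) :=
  (List.range 5).flatMap fun y => (List.range 5).flatMap fun x => (List.range x).flatMap fun z =>
    match (List.range 5).filter (fun w => w ∉ [x, y, z]) with
    | [p, q] => [[x, y, z, p, q]]
    | _ => []

/-- The copies of `P₃ ∪ 2P₂` on the vertices below 7, as a path followed by two edges. -/
def copies₇ : List (List ℕ) :=
  (List.range 7).flatMap fun y => (List.range 7).flatMap fun x => (List.range x).flatMap fun z =>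
    match (List.range 7).filter (fun w => w ∉ [x, y, z]) with
    | [p, q, r, s] => [[x, y, z, p, q, r, s], [x, y, z, p, r, q, s], [x, y, z, p, s, q, r]]
    | _ => []

/-- The slots of a path followed by edges. -/
def slotsOf : List ℕ → List ℕ
  | [x, y, z, p, q] => [slot x y, slot y z, slot p q]
  | [x, y, z, p, q, r, s] => [slot x y, slot y z, slot p q, slot r s]
  | _ => []

/-- Search data: an entry `(e, some s)` has the colour of `s`, and an entry `(e, none)` is only
constrained by the copies in `cs` whose other edges come earlier. -/
def searchData (cs : List (List ℕ)) : List (ℕ × Option ℕ) → List ℕ → List (ℕ × List (List ℕ))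
  | [], _ => []
  | (e, some s) :: es, done => (e, [[s]]) :: searchData cs es (e :: done)
  | (e, none) :: es, done =>
    (e, (cs.filter fun q => q.contains e && q.all fun s => s == e || done.contains s).map
      (·.erase e)) :: searchData cs es (e :: done)

/-- Entries for edges of unknown colour. -/
def free (l : List (ℕ × ℕ)) : List (ℕ × Option ℕ) := l.map fun p => (slot p.1 p.2, none)

/-- Entries for edges with the colour of `s`. -/
def tied (l : List (ℕ × ℕ)) (s : ℕ) : List (ℕ × Option ℕ) :=
  l.map fun p => (slot p.1 p.2, some s)

/-- Entries for the edges of a complete graph on five vertices. -/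
def order₅ : List (ℕ × Option ℕ) :=
  free [(0, 1), (2, 3), (2, 4), (3, 4), (0, 2), (1, 2), (0, 3), (1, 3), (0, 4), (1, 4)]

/-- Entries for the edges of a complete graph on seven vertices in which `12` isolates `0`, and one
of two further isolations holds. -/
def isolated₇ : List (ℕ × Option ℕ) :=
  free [(0, 3)] ++ tied [(0, 4), (0, 5), (0, 6), (1, 2)] (slot 0 3)

/-- The case in which `03` isolates `4`. -/
def order₃₄ : List (ℕ × Option ℕ) :=
  isolated₇ ++ tied [(4, 5), (4, 6), (1, 4), (2, 4)] (slot 0 3) ++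
    free [(1, 3), (2, 5), (2, 6), (1, 6), (3, 4), (0, 1), (0, 2), (1, 5), (2, 3), (3, 5), (3, 6),
      (5, 6)]

/-- The case in which `03` isolates `1`. -/
def order₃₁ : List (ℕ × Option ℕ) :=
  isolated₇ ++ tied [(1, 4), (1, 5), (1, 6)] (slot 0 3) ++
    free [(3, 4), (2, 5), (2, 6), (1, 3), (4, 5), (0, 2), (3, 6), (0, 1), (4, 6), (3, 5), (2, 4),
      (5, 6), (2, 3)]

/-- The case in which `01` isolates `3`. -/
def order₁₃ : List (ℕ × Option ℕ) :=
  isolated₇ ++ free [(0, 1)] ++ tied [(3, 4), (3, 5), (3, 6), (2, 3)] (slot 0 1) ++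
    free [(4, 6), (1, 5), (2, 6), (1, 4), (1, 6), (1, 3), (0, 2), (4, 5), (2, 4), (2, 5), (5, 6)]

/-- The case in which `01` isolates `2`. -/
def order₁₂ : List (ℕ × Option ℕ) :=
  isolated₇ ++ free [(0, 1)] ++ tied [(2, 3), (2, 4), (2, 5), (2, 6)] (slot 0 1) ++
    free [(3, 4), (1, 5), (5, 6), (3, 6), (1, 4), (0, 2), (4, 5), (1, 6), (1, 3), (3, 5), (4, 6)]

set_option maxRecDepth 100000 in
theorem search_order₅ :
    search 3 (searchData (copies₅.map slotsOf) order₅ []) (2 ^ 448 - 1) 0 = true := by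
  decide +kernel

set_option maxRecDepth 100000 in
theorem search_order₃₄ :
    search 8 (searchData (copies₇.map slotsOf) order₃₄ []) (2 ^ 448 - 1) 0 = true := by
  decide +kernel

set_option maxRecDepth 100000 in
theorem search_order₁₃ :
    search 8 (searchData (copies₇.map slotsOf) order₁₃ []) (2 ^ 448 - 1) 0 = true := by
  decide +kernel

set_option maxRecDepth 100000 in
theorem search_order₁₂ :
    search 8 (searchData (copies₇.map slotsOf) order₁₂ []) (2 ^ 448 - 1) 0 = true := by
  decide +kernel

set_option maxRecDepth 100000 in
theorem search_order₃₁ :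
    search 8 (searchData (copies₇.map slotsOf) order₃₁ []) (2 ^ 448 - 1) 0 = true := by
  decide +kernel

end SearchData

section SearchData

theorem map_fst_searchData (cs : List (List ℕ)) (es : List (ℕ × Option ℕ)) (done : List ℕ) :
    (searchData cs es done).map Prod.fst = es.map Prod.fst := by
  induction es generalizing done with
  | nil => rfl
  | cons x es ih =>
    obtain ⟨e, _ | s⟩ := x <;> simp [searchData, ih]

theorem of_mem_searchData {cs : List (List ℕ)} {es : List (ℕ × Option ℕ)} {done : List ℕ}
    {x : ℕ × List (List ℕ)} (hx : x ∈ searchData cs es done) {l : List ℕ} (hl : l ∈ x.2) :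
    (∃ s, (x.1, some s) ∈ es ∧ l = [s]) ∨ ∃ q ∈ cs, x.1 ∈ q ∧ l = q.erase x.1 := by
  induction es generalizing done with
  | nil => simp [searchData] at hx
  | cons y es ih =>
    obtain ⟨e, _ | s⟩ := y
    · rw [searchData, List.mem_cons] at hx
      rcases hx with rfl | hx
      · simp only [List.mem_map, List.mem_filter, Bool.and_eq_true, List.contains_iff_mem] at hl
        obtain ⟨q, ⟨hq, hmem, -⟩, rfl⟩ := hl
        exact .inr ⟨q, hq, hmem, rfl⟩
      · rcases ih hx with ⟨s, hs, h⟩ | h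
        · exact .inl ⟨s, List.mem_cons_of_mem _ hs, h⟩
        · exact .inr h
    · rw [searchData, List.mem_cons] at hx
      rcases hx with rfl | hx
      · exact .inl ⟨s, by simp, by simpa using hl⟩
      · rcases ih hx with ⟨s, hs, h⟩ | h
        · exact .inl ⟨s, List.mem_cons_of_mem _ hs, h⟩
        · exact .inr h

/-- The first components of `es` are the slots of the pairs of numbers below `N`, and its second
components are among them. -/
def Covers (N : ℕ) (es : List (ℕ × Option ℕ)) : Prop :=
  (es.map Prod.fst).Nodup ∧ (∀ i < N, ∀ j < N, i ≠ j → slot i j ∈ es.map Prod.fst) ∧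
    (∀ e ∈ es.map Prod.fst, ∃ i < N, ∃ j < N, i ≠ j ∧ e = slot i j) ∧
    ∀ x ∈ es, ∀ s ∈ x.2, s ∈ es.map Prod.fst

instance (N : ℕ) (es : List (ℕ × Option ℕ)) : Decidable (Covers N es) := by
  unfold Covers; infer_instance

theorem covers_order₅ : Covers 5 order₅ := by decide +kernel
theorem covers_order₃₄ : Covers 7 order₃₄ := by decide +kernel
theorem covers_order₃₁ : Covers 7 order₃₁ := by decide +kernel
theorem covers_order₁₃ : Covers 7 order₁₃ := by decide +kernel
theorem covers_order₁₂ : Covers 7 order₁₂ := by decide +kernel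

theorem slot_spec : ∀ i < 7, ∀ j < 7, i ≠ j →
    (8 ∣ slot i j ∧ 64 ≤ slot i j) ∧ (slot i j / 56 - 2 = i ∧ slot i j % 56 / 8 = j ∨
      slot i j / 56 - 2 = j ∧ slot i j % 56 / 8 = i) := by decide +kernel

theorem copies₅_spec : ∀ q ∈ copies₅, q.length = 5 ∧ q.Nodup ∧ ∀ a ∈ q, a < 5 := by
  decide +kernel

theorem copies₇_spec : ∀ q ∈ copies₇, q.length = 7 ∧ q.Nodup ∧ ∀ a ∈ q, a < 7 := by
  decide +kernel

variable {V : Type*} {c : V → V → ℕ} {S : Finset V}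

/-- The colour stored at a slot. -/
def slotColor (c : V → V → ℕ) (v : ℕ → V) (e : ℕ) : ℕ := c (v (e / 56 - 2)) (v (e % 56 / 8))

theorem slotColor_slot (hc : ∀ a b, c a b = c b a) (v : ℕ → V) {i j : ℕ} (hi : i < 7) (hj : j < 7)
    (hij : i ≠ j) : slotColor c v (slot i j) = c (v i) (v j) := by
  rcases (slot_spec i hi j hj hij).2 with ⟨h1, h2⟩ | ⟨h1, h2⟩
  · rw [slotColor, h1, h2]
  · rw [slotColor, h1, h2, hc]

open Finset Classical

set_option exponentiation.threshold 512 in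
theorem of_search {P : Prop} {N r : ℕ} (hN : N ≤ 7) (hr8 : r ≤ 8) (hc : ∀ a b, c a b = c b a)
    {v : ℕ → V} (hv : Set.InjOn v (range N)) (hS : S = (range N).image v) (hr : #(cols c S) = r)
    {es : List (ℕ × Option ℕ)} (hes : Covers N es)
    (htied : ∀ x ∈ es, ∀ s ∈ x.2, slotColor c v x.1 = slotColor c v s) {cs : List (List ℕ)}
    (hcs : ∀ q ∈ cs, (∀ s ∈ q, s ∈ es.map Prod.fst) ∧ ((q.map (slotColor c v)).Nodup → P))
    (hs : search r (searchData cs es []) (2 ^ 448 - 1) 0 = true) : P := by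
  obtain ⟨hnd, hall, hslot, hmem⟩ := hes
  have hU : ∀ e ∈ (es.map Prod.fst).toFinset, 8 ∣ e ∧ 64 ≤ e := by
    intro e he
    obtain ⟨i, hi, j, hj, hij, rfl⟩ := hslot e (List.mem_toFinset.1 he)
    exact (slot_spec i (by omega) j (by omega) hij).1
  have hcols : (es.map Prod.fst).toFinset.image (slotColor c v) = cols c S := by
    ext γ
    rw [mem_image, mem_cols]
    constructor
    · rintro ⟨e, he, rfl⟩
      obtain ⟨i, hi, j, hj, hij, rfl⟩ := hslot e (List.mem_toFinset.1 he)
      rw [hS]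
      exact ⟨v i, mem_image_of_mem _ (mem_range.2 hi), v j, mem_image_of_mem _ (mem_range.2 hj),
        fun h => hij (hv (by simpa using hi) (by simpa using hj) h),
        (slotColor_slot hc v (by omega) (by omega) hij).symm⟩
    · rintro ⟨a, ha, b, hb, hab, rfl⟩
      rw [hS, mem_image] at ha hb
      obtain ⟨i, hi, rfl⟩ := ha
      obtain ⟨j, hj, rfl⟩ := hb
      rw [mem_range] at hi hj
      have hij : i ≠ j := by rintro rfl; exact hab rfl
      exact ⟨_, List.mem_toFinset.2 (hall i hi j hj hij),
        slotColor_slot hc v (by omega) (by omega) hij⟩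
  refine search_sound hU (hcols ▸ hr) hr8 (searchData cs es []) ∅ (2 ^ 448 - 1) id
    (by rwa [map_fst_searchData]) (by simp) (by simp [map_fst_searchData]) ?_ (by simp) ?_ (by simp)
    (by simp) (by simpa using hs)
  · intro x hx l hl
    rcases of_mem_searchData hx hl with ⟨s, hs, rfl⟩ | ⟨q, hq, hxq, rfl⟩
    · refine ⟨fun s' hs' => ?_, fun hnd => ?_⟩
      · rw [List.mem_singleton.1 hs']
        exact List.mem_toFinset.2 (hmem _ hs s rfl)
      · simp [htied _ hs s rfl] at hnd
    · refine ⟨fun s hs => List.mem_toFinset.2 ((hcs q hq).1 s (List.mem_of_mem_erase hs)),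
        fun hnd => (hcs q hq).2 ?_⟩
      exact (((List.perm_cons_erase hxq).map _).nodup_iff).2 hnd
  · intro x hx
    have : x.1 ∈ es.map Prod.fst := by
      rw [← map_fst_searchData cs es []]; exact List.mem_map_of_mem hx
    obtain ⟨i, hi, j, hj, hij, h⟩ := hslot _ this
    rw [h]
    have h448 : ∀ i < 7, ∀ j < 7, i ≠ j → byteAt (2 ^ 448 - 1) (slot i j) = 255 := by
      decide +kernel
    exact h448 i (by omega) j (by omega) hij

theorem rainbowTiling_one_one {x y z p q : V} (h : [x, y, z, p, q].Nodup)
    (hcol : [c x y, c y z, c p q].Nodup) :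
    ∃ A, RainbowTiling c 1 1 [x, y, z, p, q].toFinset A := by
  simp only [List.nodup_cons, List.mem_cons, List.not_mem_nil, not_or, or_false] at h hcol
  refine ⟨_, .path (x := x) (y := y) (z := z) (A := insert (c p q) ∅) (by simp) (by simp) (by simp)
    (by tauto) (by tauto) (by tauto) (by simp; tauto) (by simp; tauto) (by tauto)
    (.edge (a := p) (b := q) ?_ ?_ (by tauto) (by simp) ?_)⟩
  · simp; grind
  · simp; grind
  · convert RainbowTiling.empty
    ext w; simp; grind

theorem rainbowTiling_one_two {x y z p q r s : V} (h : [x, y, z, p, q, r, s].Nodup)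
    (hcol : [c x y, c y z, c p q, c r s].Nodup) :
    ∃ A, RainbowTiling c 1 2 [x, y, z, p, q, r, s].toFinset A := by
  simp only [List.nodup_cons, List.mem_cons, List.not_mem_nil, not_or, or_false] at h hcol
  refine ⟨_, .path (x := x) (y := y) (z := z) (A := insert (c p q) (insert (c r s) ∅)) (by simp)
    (by simp) (by simp)
    (by tauto) (by tauto) (by tauto) (by simp; tauto) (by simp; tauto) (by tauto)
    (.edge (a := p) (b := q) ?_ ?_ (by tauto) (by simp; tauto) (.edge (a := r) (b := s) ?_ ?_
      (by tauto) (by simp) ?_))⟩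
  · simp; grind
  · simp; grind
  · simp; grind
  · simp; grind
  · convert RainbowTiling.empty
    ext w; simp; grind

theorem image_range_eq {N : ℕ} {v : ℕ → V} {t : List ℕ} (hlen : t.length = N) (hnd : t.Nodup)
    (hlt : ∀ a ∈ t, a < N) : (range N).image v = (t.map v).toFinset := by
  have : t.toFinset = range N := by
    apply eq_of_subset_of_card_le
    · intro a ha; exact mem_range.2 (hlt a (List.mem_toFinset.1 ha))
    · rw [List.toFinset_card_of_nodup hnd, hlen, card_range]
  rw [← this]
  ext; simp

theorem exists_enum {l : List V} (hl : l.Nodup) (hlS : ∀ a ∈ l, a ∈ S) :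
    ∃ l' : List V, (l ++ l').Nodup ∧ S = (l ++ l').toFinset := by
  refine ⟨(S \ l.toFinset).toList, ?_, ?_⟩
  · rw [List.nodup_append]
    refine ⟨hl, nodup_toList _, ?_⟩
    rintro a ha b hb rfl
    simp [ha] at hb
  · ext a
    simp
    grind

end SearchData

section SmallCases

open Finset Classical

variable {V : Type*} {c : V → V → ℕ} {S : Finset V}

theorem exists_getD_eq {l : List V} (hl : l.Nodup) (d : V) :
    Set.InjOn (fun i => l.getD i d) (range l.length) ∧
      l.toFinset = (range l.length).image fun i => l.getD i d := by
  constructor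
  · intro i hi j hj h
    simp only [coe_range, Set.mem_Iio] at hi hj
    simp only [List.getD_eq_getElem _ _ hi, List.getD_eq_getElem _ _ hj] at h
    exact (hl.getElem_inj_iff).1 h
  · ext a
    rw [List.mem_toFinset, List.mem_iff_getElem, mem_image]
    constructor
    · rintro ⟨i, hi, rfl⟩
      exact ⟨i, mem_range.2 hi, List.getD_eq_getElem _ _ hi⟩
    · rintro ⟨i, hi, rfl⟩
      exact ⟨i, mem_range.1 hi, (List.getD_eq_getElem _ _ (mem_range.1 hi)).symm⟩

theorem nodup_map_of_lt {N : ℕ} {v : ℕ → V} (hv : Set.InjOn v (range N)) {t : List ℕ}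
    (hnd : t.Nodup) (hlt : ∀ a ∈ t, a < N) : (t.map v).Nodup :=
  hnd.map_on fun a ha b hb h => hv (by simpa using hlt a ha) (by simpa using hlt b hb) h

theorem exists_rainbowTiling_one_one (hc : ∀ a b, c a b = c b a) (hS : #S = 5)
    (hr : #(cols c S) = 3) : ∃ A, RainbowTiling c 1 1 S A := by
  obtain ⟨l, hnd, hSl⟩ := exists_enum (S := S) (l := []) (by simp) (by simp)
  rw [List.nil_append] at hnd hSl
  have hlen : l.length = 5 := by rw [← List.toFinset_card_of_nodup hnd, ← hSl, hS]
  obtain ⟨d, -⟩ := card_pos.1 (by omega : 0 < #S)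
  obtain ⟨hv, himage⟩ := exists_getD_eq hnd d
  rw [hlen] at hv himage
  set v := fun i => l.getD i d
  refine of_search (by norm_num) (by norm_num) hc hv (hSl.trans himage) hr covers_order₅
    (by simp [order₅, free]) (cs := copies₅.map slotsOf) ?_ search_order₅
  intro q hq
  obtain ⟨t, ht, rfl⟩ := List.mem_map.1 hq
  obtain ⟨hl, hnd', hlt⟩ := copies₅_spec t ht
  rw [hSl, himage, image_range_eq hl hnd' hlt]
  have hnd'' := nodup_map_of_lt hv hnd' hlt
  obtain ⟨x, y, z, p, q, rfl⟩ : ∃ x y z p q, t = [x, y, z, p, q] := by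
    match t, hl with
    | [x, y, z, p, q], _ => exact ⟨x, y, z, p, q, rfl⟩
  simp only [List.forall_mem_cons] at hlt
  simp only [List.nodup_cons, List.mem_cons, List.not_mem_nil, not_or, or_false] at hnd'
  constructor
  · simp only [slotsOf, List.forall_mem_cons]
    refine ⟨?_, ?_, ?_, by simp⟩ <;> apply covers_order₅.2.1 <;> tauto
  · intro h
    rw [slotsOf, List.map_cons, List.map_cons, List.map_cons, List.map_nil,
      slotColor_slot hc, slotColor_slot hc, slotColor_slot hc] at h
    · exact rainbowTiling_one_one hnd'' h
    all_goals tauto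

theorem exists_rainbowTiling_one_two (hc : ∀ a b, c a b = c b a) {v : ℕ → V}
    (hv : Set.InjOn v (range 7)) (hS : S = (range 7).image v) (hr : #(cols c S) = 8)
    {es : List (ℕ × Option ℕ)} (hes : Covers 7 es)
    (htied : ∀ x ∈ es, ∀ s ∈ x.2, slotColor c v x.1 = slotColor c v s)
    (hs : search 8 (searchData (copies₇.map slotsOf) es []) (2 ^ 448 - 1) 0 = true) :
    ∃ A, RainbowTiling c 1 2 S A := by
  refine of_search (by norm_num) (by norm_num) hc hv hS hr hes htied ?_ hs
  intro q hq
  obtain ⟨t, ht, rfl⟩ := List.mem_map.1 hq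
  obtain ⟨hl, hnd', hlt⟩ := copies₇_spec t ht
  rw [hS, image_range_eq hl hnd' hlt]
  have hnd'' := nodup_map_of_lt hv hnd' hlt
  obtain ⟨x, y, z, p, q, r, s, rfl⟩ : ∃ x y z p q r s, t = [x, y, z, p, q, r, s] := by
    match t, hl with
    | [x, y, z, p, q, r, s], _ => exact ⟨x, y, z, p, q, r, s, rfl⟩
  simp only [List.forall_mem_cons] at hlt
  simp only [List.nodup_cons, List.mem_cons, List.not_mem_nil, not_or, or_false] at hnd'
  constructor
  · simp only [slotsOf, List.forall_mem_cons]
    refine ⟨?_, ?_, ?_, ?_, by simp⟩ <;> apply hes.2.1 <;> tauto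
  · intro h
    rw [slotsOf, List.map_cons, List.map_cons, List.map_cons, List.map_cons, List.map_nil,
      slotColor_slot hc, slotColor_slot hc, slotColor_slot hc, slotColor_slot hc] at h
    · exact rainbowTiling_one_two hnd'' h
    all_goals tauto

theorem exists_enum_seven (hS : #S = 7) {l : List V} (hl : l.Nodup) (hlS : ∀ a ∈ l, a ∈ S) :
    ∃ v : ℕ → V, Set.InjOn v (range 7) ∧ S = (range 7).image v ∧
      ∀ i a, l[i]? = some a → v i = a := by
  obtain ⟨l', hnd, hSl⟩ := exists_enum hl hlS
  have hlen : (l ++ l').length = 7 := by rw [← List.toFinset_card_of_nodup hnd, ← hSl, hS]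
  obtain ⟨d, -⟩ := card_pos.1 (by omega : 0 < #S)
  obtain ⟨hv, himage⟩ := exists_getD_eq hnd d
  rw [hlen] at hv himage
  refine ⟨_, hv, hSl.trans himage, fun i a h => ?_⟩
  have hi : i < l.length := by
    by_contra hi
    simp [List.getElem?_eq_none (not_lt.1 hi)] at h
  simp [List.getElem?_append_left hi, h]

/-- The tied entries of an order have the right colours if all of these edges have colour `γ`. -/
theorem forall_mem_tied (hc : ∀ a b, c a b = c b a) {v : ℕ → V} {l : List (ℕ × ℕ)} {i j : ℕ}
    (hi : i < 7) (hj : j < 7) (hij : i ≠ j) (hl : ∀ p ∈ l, p.1 < 7 ∧ p.2 < 7 ∧ p.1 ≠ p.2)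
    (h : ∀ p ∈ l, c (v p.1) (v p.2) = c (v i) (v j)) :
    ∀ x ∈ tied l (slot i j), ∀ s ∈ x.2, slotColor c v x.1 = slotColor c v s := by
  intro x hx s hs
  obtain ⟨p, hp, rfl⟩ := List.mem_map.1 hx
  obtain rfl : slot i j = s := by simpa using hs
  rw [slotColor_slot hc v hi hj hij, slotColor_slot hc v (hl p hp).1 (hl p hp).2.1 (hl p hp).2.2,
    h p hp]

theorem forall_mem_free {v : ℕ → V} {l : List (ℕ × ℕ)} :
    ∀ x ∈ free l, ∀ s ∈ x.2, slotColor c v x.1 = slotColor c v s := by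
  intro x hx s hs
  obtain ⟨p, hp, rfl⟩ := List.mem_map.1 hx
  simp at hs

theorem Isolates.color {v : ℕ → V} (hv : Set.InjOn v (range 7)) (hS : S = (range 7).image v)
    {a b d : ℕ} (ha : a < 7) (hb : b < 7) (hd : d < 7) (h : Isolates c S (v a) (v b) (v d)) {i : ℕ}
    (hi : i < 7) (hia : i ≠ a) (hib : i ≠ b) (hid : i ≠ d) : c (v d) (v i) = c (v a) (v b) := by
  have hne : ∀ j < 7, i ≠ j → v i ≠ v j := fun j hj hij h =>
    hij (hv (by simpa using hi) (by simpa using hj) h)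
  exact h.2.2 _ (hS ▸ mem_image_of_mem _ (mem_range.2 hi)) (hne _ ha hia) (hne _ hb hib)
    (hne _ hd hid)

theorem Isolates.isolated₇ (hc : ∀ a b, c a b = c b a) {v : ℕ → V} (hv : Set.InjOn v (range 7))
    (hS : S = (range 7).image v) (h : Isolates c S (v 1) (v 2) (v 0)) :
    ∀ x ∈ isolated₇, ∀ s ∈ x.2, slotColor c v x.1 = slotColor c v s := by
  have h0 : ∀ i, 3 ≤ i → i < 7 → c (v 0) (v i) = c (v 1) (v 2) := fun i hi hi' =>
    h.color hv hS (by norm_num) (by norm_num) (by norm_num) hi' (by omega) (by omega) (by omega)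
  refine List.forall_mem_append.2 ⟨forall_mem_free, forall_mem_tied hc (by norm_num) (by norm_num)
    (by norm_num) (by decide) ?_⟩
  rw [h0 3 (by norm_num) (by norm_num)]
  intro p hp
  simp only [List.mem_cons, List.not_mem_nil, or_false] at hp
  rcases hp with rfl | rfl | rfl | rfl
  exacts [h0 4 (by norm_num) (by norm_num), h0 5 (by norm_num) (by norm_num),
    h0 6 (by norm_num) (by norm_num), rfl]

theorem Isolates.tied (hc : ∀ a b, c a b = c b a) {v : ℕ → V} (hv : Set.InjOn v (range 7))
    (hS : S = (range 7).image v) {a b d : ℕ} (ha : a < 7) (hb : b < 7) (hd : d < 7) (hab : a ≠ b)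
    (h : Isolates c S (v a) (v b) (v d)) {l : List (ℕ × ℕ)}
    (hl : ∀ p ∈ l, ∃ i < 7, i ≠ a ∧ i ≠ b ∧ i ≠ d ∧ (p = (d, i) ∨ p = (i, d))) :
    ∀ x ∈ tied l (slot a b), ∀ s ∈ x.2, slotColor c v x.1 = slotColor c v s := by
  refine forall_mem_tied hc ha hb hab ?_ ?_
  · intro p hp
    obtain ⟨i, hi, -, -, hid, rfl | rfl⟩ := hl p hp
    exacts [⟨hd, hi, hid.symm⟩, ⟨hi, hd, hid⟩]
  · intro p hp
    obtain ⟨i, hi, hia, hib, hid, rfl | rfl⟩ := hl p hp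
    · exact h.color hv hS ha hb hd hi hia hib hid
    · rw [hc]
      exact h.color hv hS ha hb hd hi hia hib hid

theorem exists_rainbowTiling_of_isolates_aux (hc : ∀ a b, c a b = c b a) (hS : #S = 7)
    (hr : #(cols c S) = 8) {u v z x z' : V} (h : Isolates c S u v z) (h' : Isolates c S z x z')
    (hx : z' ≠ v ∧ x ≠ v ∨ x = u) : ∃ A, RainbowTiling c 1 2 S A := by
  obtain ⟨⟨hu, hv, hz⟩, ⟨huv, hzu, hzv⟩, -⟩ := id h
  obtain ⟨⟨-, hxS, hz'⟩, ⟨hzx, hz'z, hz'x⟩, -⟩ := id h'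
  by_cases hxu : x = u
  · subst hxu
    by_cases hz'v : z' = v
    · subst hz'v
      obtain ⟨w, hw, hSw, hval⟩ := exists_enum_seven hS (l := [z, x, z']) (by simp; grind)
        (by simp; tauto)
      obtain rfl := hval 0 z rfl
      obtain rfl := hval 1 x rfl
      obtain rfl := hval 2 z' rfl
      refine exists_rainbowTiling_one_two hc hw hSw hr covers_order₁₂
        (List.forall_mem_append.2 ⟨List.forall_mem_append.2 ⟨List.forall_mem_append.2
          ⟨h.isolated₇ hc hw hSw, forall_mem_free⟩, ?_⟩, forall_mem_free⟩) search_order₁₂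
      exact h'.tied hc hw hSw (by norm_num) (by norm_num) (by norm_num) (by norm_num) (by decide)
    · obtain ⟨w, hw, hSw, hval⟩ := exists_enum_seven hS (l := [z, x, v, z']) (by simp; grind)
        (by simp; tauto)
      obtain rfl := hval 0 z rfl
      obtain rfl := hval 1 x rfl
      obtain rfl := hval 2 v rfl
      obtain rfl := hval 3 z' rfl
      refine exists_rainbowTiling_one_two hc hw hSw hr covers_order₁₃
        (List.forall_mem_append.2 ⟨List.forall_mem_append.2 ⟨List.forall_mem_append.2
          ⟨h.isolated₇ hc hw hSw, forall_mem_free⟩, ?_⟩, forall_mem_free⟩) search_order₁₃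
      exact h'.tied hc hw hSw (by norm_num) (by norm_num) (by norm_num) (by norm_num) (by decide)
  · obtain ⟨hz'v, hxv⟩ := hx.resolve_right hxu
    by_cases hz'u : z' = u
    · subst hz'u
      obtain ⟨w, hw, hSw, hval⟩ := exists_enum_seven hS (l := [z, z', v, x]) (by simp; grind)
        (by simp; tauto)
      obtain rfl := hval 0 z rfl
      obtain rfl := hval 1 z' rfl
      obtain rfl := hval 2 v rfl
      obtain rfl := hval 3 x rfl
      refine exists_rainbowTiling_one_two hc hw hSw hr covers_order₃₁
        (List.forall_mem_append.2 ⟨List.forall_mem_append.2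
          ⟨h.isolated₇ hc hw hSw, ?_⟩, forall_mem_free⟩) search_order₃₁
      exact h'.tied hc hw hSw (by norm_num) (by norm_num) (by norm_num) (by norm_num) (by decide)
    · obtain ⟨w, hw, hSw, hval⟩ := exists_enum_seven hS (l := [z, u, v, x, z']) (by simp; grind)
        (by simp; tauto)
      obtain rfl := hval 0 z rfl
      obtain rfl := hval 1 u rfl
      obtain rfl := hval 2 v rfl
      obtain rfl := hval 3 x rfl
      obtain rfl := hval 4 z' rfl
      refine exists_rainbowTiling_one_two hc hw hSw hr covers_order₃₄
        (List.forall_mem_append.2 ⟨List.forall_mem_append.2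
          ⟨h.isolated₇ hc hw hSw, ?_⟩, forall_mem_free⟩) search_order₃₄
      exact h'.tied hc hw hSw (by norm_num) (by norm_num) (by norm_num) (by norm_num) (by decide)

theorem Bad.exists_rainbowTiling (h : Bad c S) (hS : #S = 7) : ∃ A, RainbowTiling c 1 2 S A := by
  obtain ⟨u, v, z, hI⟩ := h.exists_isolates
  obtain ⟨x, z', hI'⟩ := h.exists_isolates_of_isolates hI
  have hr : #(cols c S) = 8 := by rw [h.card_cols, hS]; rfl
  by_cases hx : z' ≠ v ∧ x ≠ v ∨ x = u
  · exact exists_rainbowTiling_of_isolates_aux h.symm hS hr hI hI' hx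
  · refine exists_rainbowTiling_of_isolates_aux h.symm hS hr (hI.swap h.symm) hI' ?_
    by_contra hx'
    by_cases hz'v : z' = v
    · have := hI.2.1.1
      grind
    · grind

end SmallCases

section Induction

open Finset Classical

variable {V : Type*} {c : V → V → ℕ} {S : Finset V}

theorem choose_two_succ (m : ℕ) : (m + 1).choose 2 = m.choose 2 + m := by
  rw [Nat.choose_succ_succ' m 1, Nat.choose_one_right, add_comm]

/-- The colours all of whose edges meet `w`. -/
noncomputable def lostAt (c : V → V → ℕ) (S : Finset V) (w : V) : Finset ℕ :=
  cols c S \ cols c (S \ {w})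

theorem card_lostAt (w : V) : #(lostAt c S w) + #(cols c (S \ {w})) = #(cols c S) :=
  card_sdiff_add_card_eq_card (cols_mono sdiff_subset)

theorem eq_or_eq_of_mem_lostAt {w x y : V} (hx : x ∈ S) (hy : y ∈ S) (hxy : x ≠ y)
    (h : c x y ∈ lostAt c S w) : x = w ∨ y = w := by
  by_contra! hne
  exact (mem_sdiff.1 h).2 (mem_cols_of (by simp [hx, hne.1]) (by simp [hy, hne.2]) hxy)

theorem lostAt_subset_image (hc : ∀ a b, c a b = c b a) (w : V) :
    lostAt c S w ⊆ (S \ {w}).image (c w) := by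
  intro γ hγ
  obtain ⟨x, hx, y, hy, hxy, rfl⟩ := mem_cols.1 (mem_sdiff.1 hγ).1
  rcases eq_or_eq_of_mem_lostAt hx hy hxy hγ with rfl | rfl
  · exact mem_image_of_mem _ (by simp [hy, hxy.symm])
  · rw [hc]
    exact mem_image_of_mem _ (by simp [hx, hxy])

theorem lostAt_inter_subset (hc : ∀ a b, c a b = c b a) {w w' : V} (hw : w ≠ w') :
    lostAt c S w ∩ lostAt c S w' ⊆ {c w w'} := by
  intro γ hγ
  obtain ⟨h, h'⟩ := mem_inter.1 hγ
  obtain ⟨x, hx, y, hy, hxy, rfl⟩ := mem_cols.1 (mem_sdiff.1 h).1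
  rw [mem_singleton]
  rcases eq_or_eq_of_mem_lostAt hx hy hxy h with rfl | rfl <;>
    rcases eq_or_eq_of_mem_lostAt hx hy hxy h' with h1 | h1
  · exact absurd h1 hw
  · rw [h1]
  · rw [h1, hc]
  · exact absurd h1 hw

theorem sum_card_lostAt_le (hc : ∀ a b, c a b = c b a) (B : Finset V) :
    ∑ w ∈ B, #(lostAt c S w) ≤ #(cols c S) + (#B).choose 2 := by
  have key : ∑ w ∈ B, #(lostAt c S w) ≤ #(B.biUnion (lostAt c S)) + (#B).choose 2 := by
    induction B using Finset.induction_on with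
    | empty => simp
    | insert w B hw ih =>
      rw [sum_insert hw, biUnion_insert, card_insert_of_notMem hw, choose_two_succ]
      have h1 := card_union_add_card_inter (lostAt c S w) (B.biUnion (lostAt c S))
      have h2 : lostAt c S w ∩ B.biUnion (lostAt c S) ⊆ B.image (c w) := by
        intro γ hγ
        obtain ⟨h, h'⟩ := mem_inter.1 hγ
        obtain ⟨w', hw', h'⟩ := mem_biUnion.1 h'
        have := lostAt_inter_subset hc (by rintro rfl; exact hw hw') (mem_inter.2 ⟨h, h'⟩)
        exact mem_image.2 ⟨w', hw', (mem_singleton.1 this).symm⟩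
      have h3 := (card_le_card h2).trans card_image_le
      omega
  refine key.trans (Nat.add_le_add_right (card_le_card ?_) _)
  exact biUnion_subset.2 fun w _ => sdiff_subset

/-- A path `w a b` with private colours whose removal leaves enough colours. -/
theorem exists_path (hc : ∀ a b, c a b = c b a) (hn : 10 ≤ #S)
    (hr : #(cols c S) = (#S - 3).choose 2 + 2) {u v : V} (hu : u ∈ S) (hv : v ∈ S) (huv : u ≠ v)
    (hpriv : c u v ∉ cols c (S \ {u, v})) (hlow : #S ≤ #(lost c S u v) + 3)
    (hgood : (#S - 5).choose 2 + 2 ≤ #(cols c (S \ {u, v}))) :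
    ∃ a ∈ S, ∃ b ∈ S, ∃ w ∈ S, a ≠ b ∧ w ≠ a ∧ w ≠ b ∧ c a w ≠ c a b ∧
      c a w ∉ cols c (S \ {w, a, b}) ∧ c a b ∉ cols c (S \ {w, a, b}) ∧
      (#S - 6).choose 2 + 2 ≤ #(cols c (S \ {w, a, b})) := by
  set T := S \ {u, v} with hT
  have hTc : #T + 2 = #S := card_sdiff_pair' hu hv huv
  have hTw : ∀ w, T \ {w} = S \ {w, u, v} := fun w => by ext; simp [hT]; tauto
  have hTw' : ∀ w, T \ {w} = S \ {w, v, u} := fun w => by ext; simp [hT]; tauto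
  have hprivw : ∀ w, c u v ∉ cols c (T \ {w}) := fun w h => hpriv (cols_mono sdiff_subset h)
  by_contra hno
  set B := {w ∈ T | (c u w ≠ c u v ∧ c u w ∉ cols c (T \ {w})) ∨
    (c v w ≠ c u v ∧ c v w ∉ cols c (T \ {w}))} with hB
  have hBbound : ∀ w ∈ B, #(cols c (T \ {w})) ≤ (#S - 6).choose 2 + 1 := by
    intro w hw
    by_contra! hlt
    rw [hB, mem_filter] at hw
    obtain ⟨hwT, hw⟩ := hw
    simp only [hT, mem_sdiff, mem_insert, mem_singleton, not_or] at hwT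
    apply hno
    rcases hw with ⟨h1, h2⟩ | ⟨h1, h2⟩
    · refine ⟨u, hu, v, hv, w, hwT.1, huv, hwT.2.1, hwT.2.2, h1, ?_⟩
      rw [← hTw]
      exact ⟨h2, hprivw w, hlt⟩
    · refine ⟨v, hv, u, hu, w, hwT.1, huv.symm, hwT.2.2, hwT.2.1, by rwa [hc v u], ?_⟩
      rw [← hTw', hc v u]
      exact ⟨h2, hprivw w, hlt⟩
  have hlost : lost c S u v ⊆ insert (c u v) (B.image (c u) ∪ B.image (c v)) := by
    intro γ hγ
    obtain ⟨hγ, hγT⟩ := mem_filter.1 hγ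
    by_cases hγuv : γ = c u v
    · simp [hγuv]
    have huse : ∀ w ∈ T, ∀ a, (a = u ∨ a = v) → c a w = γ →
        γ ∈ insert (c u v) (B.image (c u) ∪ B.image (c v)) := by
      intro w hw a ha haw
      have hγw : γ ∉ cols c (T \ {w}) := fun h => hγT (cols_mono sdiff_subset h)
      have hwB : w ∈ B := by
        rw [hB, mem_filter]
        rcases ha with rfl | rfl
        · exact ⟨hw, .inl ⟨by rwa [haw], by rwa [haw]⟩⟩
        · exact ⟨hw, .inr ⟨by rwa [haw], by rwa [haw]⟩⟩
      rw [mem_insert, mem_union]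
      rcases ha with rfl | rfl
      · exact .inr (.inl (mem_image.2 ⟨w, hwB, haw⟩))
      · exact .inr (.inr (mem_image.2 ⟨w, hwB, haw⟩))
    obtain ⟨x, hx, y, hy, hxy, hxyγ⟩ := mem_cols.1 hγ
    by_cases hxT : x ∈ T <;> by_cases hyT : y ∈ T
    · exact absurd (mem_cols.2 ⟨x, hxT, y, hyT, hxy, hxyγ⟩) hγT
    · exact huse x hxT y (by simp [hT, hy] at hyT; tauto) (by rwa [hc])
    · exact huse y hyT x (by simp [hT, hx] at hxT; tauto) hxyγ
    · exfalso
      simp only [hT, mem_sdiff, hx, hy, true_and, mem_insert, mem_singleton, not_not] at hxT hyT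
      apply hγuv
      rcases hxT with rfl | rfl <;> rcases hyT with rfl | rfl
      · exact absurd rfl hxy
      · exact hxyγ.symm
      · rw [← hxyγ, hc]
      · exact absurd rfl hxy
  have hK : #(lost c S u v) ≤ 2 * #B + 1 := by
    have h1 := (card_le_card hlost).trans (card_insert_le _ _)
    have h2 := card_union_le (B.image (c u)) (B.image (c v))
    have h3 : #(B.image (c u)) ≤ #B := card_image_le
    have h4 : #(B.image (c v)) ≤ #B := card_image_le
    omega
  have hsum := card_lost (c := c) (S := S) u v
  rw [← hT] at hsum
  obtain ⟨m, hm⟩ : ∃ m, #S = m + 6 := ⟨#S - 6, by omega⟩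
  have e3 : (#S - 3).choose 2 = m.choose 2 + 3 * m + 3 := by
    rw [hm, show m + 6 - 3 = m + 1 + 1 + 1 by omega, choose_two_succ, choose_two_succ,
      choose_two_succ]
    ring
  have e5 : (#S - 5).choose 2 = m.choose 2 + m := by
    rw [hm, show m + 6 - 5 = m + 1 by omega, choose_two_succ]
  have e6 : #S - 6 = m := by omega
  rw [e6] at hBbound
  have hw1 : ∀ w ∈ B, 3 * m + 4 ≤ #(lostAt c T w) + #(lost c S u v) := by
    intro w hw
    have h1 := card_lostAt (c := c) (S := T) w
    have h2 := hBbound w hw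
    omega
  have hw2 : ∀ w ∈ B, #(lostAt c T w) ≤ m + 3 := by
    intro w hw
    have h1 := (card_le_card (lostAt_subset_image hc w)).trans (card_image_le (s := T \ {w}))
    have h2 := card_sdiff_singleton' (mem_filter.1 hw).1
    omega
  obtain ⟨w₀, hw₀⟩ : B.Nonempty := card_pos.1 (by omega)
  have := hw1 w₀ hw₀
  have := hw2 w₀ hw₀
  obtain ⟨B', hB', hB'c⟩ := exists_subset_card_eq (s := B) (n := m) (by omega)
  have hsum1 := sum_card_lostAt_le (S := T) hc B'
  have hsum2 : #B' * (3 * m + 4 - #(lost c S u v)) ≤ ∑ w ∈ B', #(lostAt c T w) := by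
    rw [← smul_eq_mul]
    exact card_nsmul_le_sum _ _ _ fun w hw => by have := hw1 w (hB' hw); omega
  have hch : m * m = 2 * m.choose 2 + m := by
    have := Nat.choose_two_right m
    have h2 := Nat.div_mul_cancel (Nat.even_mul_pred_self m).two_dvd
    obtain ⟨j, rfl⟩ : ∃ j, m = j + 1 := ⟨m - 1, by omega⟩
    rw [Nat.add_sub_cancel] at *
    nlinarith
  rw [hB'c] at hsum1 hsum2
  obtain ⟨y, hy⟩ : ∃ y, 3 * m + 4 - #(lost c S u v) = m + 1 + y := 
    ⟨2 * m + 3 - #(lost c S u v), by omega⟩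
  rw [hy, mul_add, mul_add] at hsum2
  have hy1 : y ≤ m * y := Nat.le_mul_of_pos_left y (by omega)
  omega

theorem exists_good (hc : ∀ a b, c a b = c b a) (h7 : 7 ≤ #S) (h8 : #S ≠ 8)
    (hr : #(cols c S) = (#S - 3).choose 2 + 2) :
    (∃ u ∈ S, ∃ v ∈ S, u ≠ v ∧ c u v ∉ cols c (S \ {u, v}) ∧
      (#S - 5).choose 2 + 2 ≤ #(cols c (S \ {u, v}))) ∨
    (∃ u ∈ S, ∃ v ∈ S, u ≠ v ∧ (∀ z, ¬Isolates c S u v z) ∧ c u v ∈ cols c (S \ {u, v}) ∧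
      (#S - 4).choose 2 + 3 ≤ #(cols c (S \ {u, v}))) ∨
    (#S = 7 ∧ ∃ A, RainbowTiling c 1 2 S A) := by
  by_contra! hno
  obtain ⟨hP, hN, hR⟩ := hno
  obtain ⟨m, hm⟩ : ∃ m, #S = m + 5 := ⟨#S - 5, by omega⟩
  have e3 : (#S - 3).choose 2 = m.choose 2 + 2 * m + 1 := by
    rw [hm, show m + 5 - 3 = m + 1 + 1 by omega, choose_two_succ, choose_two_succ]
    ring
  have e4 : (#S - 4).choose 2 = m.choose 2 + m := by
    rw [hm, show m + 5 - 4 = m + 1 by omega, choose_two_succ]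
  have e5 : (#S - 5).choose 2 = m.choose 2 := by rw [hm, Nat.add_sub_cancel]
  have hbad : Bad c S := by
    refine ⟨hc, h7, hr, fun u hu v hv huv h => ?_, fun u hu v hv huv h hI => ?_⟩
    · have h1 := hP u hu v hv huv h
      have h2 := card_lost (c := c) (S := S) u v
      omega
    · have h1 := hN u hu v hv huv hI h
      have h2 := card_lost (c := c) (S := S) u v
      omega
  rcases (by omega : #S = 7 ∨ 9 ≤ #S) with h | h
  · obtain ⟨A, hA⟩ := hbad.exists_rainbowTiling h
    exact hR h A hA
  · exact hbad.false_of_nine_le h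

theorem exists_card_cols_eq {r : ℕ} (hr : 1 ≤ r) (h : r ≤ #(cols c S)) :
    ∃ φ : ℕ → ℕ, #(cols (fun a b => φ (c a b)) S) = r := by
  obtain ⟨P, hP, hPr⟩ := exists_subset_card_eq h
  obtain ⟨p, hp⟩ := card_pos.1 (by omega : 0 < #P)
  refine ⟨fun γ => if γ ∈ P then γ else p, ?_⟩
  rw [← hPr]
  congr 1
  ext γ
  rw [mem_cols]
  constructor
  · rintro ⟨a, -, b, -, -, rfl⟩
    dsimp only
    split_ifs with h
    exacts [h, hp]
  · intro hγ
    obtain ⟨a, ha, b, hb, hab, rfl⟩ := mem_cols.1 (hP hγ)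
    exact ⟨a, ha, b, hb, hab, if_pos hγ⟩

theorem exists_rainbowTiling {k t : ℕ} (hc : ∀ a b, c a b = c b a) (hk : 1 ≤ k) (ht : 1 ≤ t)
    (hkt : k = 1 ∨ 2 ≤ t) (hS : #S = 3 * k + 2 * t) (hr : (#S - 3).choose 2 + 2 ≤ #(cols c S)) :
    ∃ A, RainbowTiling c k t S A := by
  induction hN : #S using Nat.strong_induction_on generalizing c S k t with
  | _ N ih =>
  wlog hr' : #(cols c S) = (#S - 3).choose 2 + 2 with H
  · obtain ⟨φ, hφ⟩ := exists_card_cols_eq (by omega) hr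
    obtain ⟨A, hA⟩ := H N ih (c := fun a b => φ (c a b)) (S := S) (fun a b => by rw [hc a b]) hk ht
      hkt hS hφ.ge hN hφ
    obtain ⟨A', -, hA'⟩ := hA.of_comp
    exact ⟨A', hA'⟩
  by_cases ht1 : t = 1
  · obtain rfl : k = 1 := by omega
    subst ht1
    exact exists_rainbowTiling_one_one hc hS (by rw [hr', hS]; rfl)
  rcases exists_good hc (by omega) (by omega) hr' with
    ⟨u, hu, v, hv, huv, hpriv, hgood⟩ | ⟨u, hu, v, hv, huv, hI, hmem, hgood⟩ | ⟨h7, hA⟩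
  · have hcard := card_sdiff_pair' hu hv huv
    obtain ⟨t, rfl⟩ : ∃ t', t = t' + 1 := ⟨t - 1, by omega⟩
    have finish : (∃ A, RainbowTiling c k t (S \ {u, v}) A) →
        ∃ A, RainbowTiling c k (t + 1) S A := fun ⟨A, hA⟩ =>
      ⟨_, .edge hu hv huv (fun h => hpriv (hA.subset_cols h)) hA⟩
    by_cases hk1 : k = 1
    · refine finish (ih _ (by omega) hc hk (by omega) (.inl hk1) (by omega) ?_ rfl)
      rwa [show #(S \ {u, v}) - 3 = #S - 5 by omega]
    by_cases hlow : #S ≤ #(lost c S u v) + 3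
    · obtain ⟨a, ha, b, hb, w, hw, hab, hwa, hwb, hne, h1, h2, h3⟩ :=
        exists_path hc (by omega) hr' hu hv huv hpriv hlow hgood
      have hcard' := card_sdiff_triple' hw ha hb hwa hab hwb
      obtain ⟨k, rfl⟩ : ∃ k', k = k' + 1 := ⟨k - 1, by omega⟩
      obtain ⟨A, hA⟩ := ih _ (by omega) hc (k := k) (t := t + 1) (S := S \ {w, a, b}) (by omega)
        (by omega) (.inr (by omega)) (by omega)
        (by rwa [show #(S \ {w, a, b}) - 3 = #S - 6 by omega]) rfl
      rw [hc a w] at h1 hne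
      exact ⟨_, .path hw ha hb hwa hab hwb (fun h => h1 (hA.subset_cols h))
        (fun h => h2 (hA.subset_cols h)) hne hA⟩
    · have e := choose_two_succ (#S - 4)
      rw [show #S - 4 + 1 = #S - 3 by omega] at e
      have h2 := card_lost (c := c) (S := S) u v
      obtain ⟨A, hA, -⟩ := rainbowTiling_avoiding (S := S \ {u, v}) hc (q := c u v) hk
        (by omega : 1 ≤ t) (by omega)
        (by rw [erase_eq_of_notMem hpriv, show #(S \ {u, v}) - 2 = #S - 4 by omega]; omega) (by
          intro z hz
          obtain ⟨w, hw⟩ := card_pos.1 (by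
            have := card_sdiff_singleton' hz
            omega : 0 < #((S \ {u, v}) \ {z}))
          obtain ⟨hw, hwz⟩ := mem_sdiff.1 hw
          rw [mem_singleton] at hwz
          refine ⟨w, hw, hwz, fun h => hpriv ?_⟩
          rw [← h]
          exact mem_cols_of hz hw (Ne.symm hwz))
      exact finish ⟨A, hA⟩
  · have hcard := card_sdiff_pair' hu hv huv
    obtain ⟨t, rfl⟩ : ∃ t', t = t' + 1 := ⟨t - 1, by omega⟩
    obtain ⟨A, hA, hqA⟩ := rainbowTiling_avoiding (S := S \ {u, v}) hc (q := c u v) hk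
      (by omega : 1 ≤ t) (by omega)
      (by rw [card_erase_of_mem hmem, show #(S \ {u, v}) - 2 = #S - 4 by omega]; omega) (by
        intro z hz
        by_contra! hno
        simp only [mem_sdiff, mem_insert, mem_singleton, not_or] at hz hno
        exact hI z ⟨⟨hu, hv, hz.1⟩, ⟨huv, hz.2.1, hz.2.2⟩, fun y hy hyu hyv hyz =>
          hno y ⟨hy, hyu, hyv⟩ hyz⟩)
    exact ⟨_, .edge hu hv huv hqA hA⟩
  · obtain rfl : k = 1 := by omega
    obtain rfl : t = 2 := by omega
    exact hA

end Induction

section Embedding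

open Finset Classical

/-- The families `x` and `y` list pairwise distinct elements of `S`. -/
def ListsDistinct {X : Type*} {k t p q : ℕ} (x : Fin k → Fin p → X) (y : Fin t → Fin q → X)
    (S : Finset X) : Prop :=
  Function.Injective (Sum.elim (Function.uncurry x) (Function.uncurry y)) ∧
    ∀ s, Sum.elim (Function.uncurry x) (Function.uncurry y) s ∈ S

section ListsDistinct

variable {X : Type*} {k t p q : ℕ} {x : Fin k → Fin p → X} {y : Fin t → Fin q → X}
  {S T : Finset X}

theorem listsDistinct_iff : ListsDistinct x y S ↔
    (∀ i a i' a', x i a = x i' a' → i = i' ∧ a = a') ∧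
    (∀ j b j' b', y j b = y j' b' → j = j' ∧ b = b') ∧
    (∀ i a j b, x i a ≠ y j b) ∧ (∀ i a, x i a ∈ S) ∧ ∀ j b, y j b ∈ S := by
  simp only [ListsDistinct, Function.Injective, Function.uncurry, Sum.forall, Prod.forall,
    Sum.elim_inl, Sum.elim_inr, Sum.inl.injEq, Sum.inr.injEq, Prod.mk.injEq, reduceCtorEq,
    imp_false]
  constructor
  · rintro ⟨⟨h1, h2⟩, h3⟩
    exact ⟨fun i a => (h1 i a).1, fun j b => (h2 j b).2, fun i a => (h1 i a).2, h3⟩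
  · rintro ⟨h1, h2, h3, h4⟩
    exact ⟨⟨fun i a => ⟨h1 i a, h3 i a⟩, fun j b => ⟨fun i a => (h3 i a j b).symm, h2 j b⟩⟩, h4⟩

theorem ListsDistinct.cons_left (h : ListsDistinct x y S) (u : Fin p → X)
    (hu : Function.Injective u) (huS : ∀ a, u a ∉ S) (huT : ∀ a, u a ∈ T) (hST : S ⊆ T) :
    ListsDistinct (Fin.cons u x : Fin (k + 1) → Fin p → X) y T := by
  rw [listsDistinct_iff] at h ⊢
  obtain ⟨h1, h2, h3, h4, h5⟩ := h
  refine ⟨fun i a i' a' => ?_, h2, fun i a j b => ?_, fun i a => ?_, fun j b => hST (h5 j b)⟩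
  · refine Fin.cases ?_ (fun i => ?_) i <;> refine Fin.cases ?_ (fun i' => ?_) i'
    · simpa using @hu a a'
    · intro h
      exact (huS a ((show u a = x i' a' from h) ▸ h4 i' a')).elim
    · intro h
      exact (huS a' ((show x i a = u a' from h) ▸ h4 i a)).elim
    · simpa using h1 i a i' a'
  · refine Fin.cases (fun h => ?_) (fun i => h3 i a j b) i
    exact huS a ((show u a = y j b from h) ▸ h5 j b)
  · exact Fin.cases (huT a) (fun i => hST (h4 i a)) i

theorem ListsDistinct.swap (h : ListsDistinct x y S) : ListsDistinct y x S := by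
  rw [listsDistinct_iff] at h ⊢
  exact ⟨h.2.1, h.1, fun i a j b => (h.2.2.1 j b i a).symm, h.2.2.2.2, h.2.2.2.1⟩

theorem ListsDistinct.cons_right (h : ListsDistinct x y S) (u : Fin q → X)
    (hu : Function.Injective u) (huS : ∀ a, u a ∉ S) (huT : ∀ a, u a ∈ T) (hST : S ⊆ T) :
    ListsDistinct x (Fin.cons u y : Fin (t + 1) → Fin q → X) T :=
  (h.swap.cons_left u hu huS huT hST).swap

end ListsDistinct

theorem RainbowTiling.exists_listsDistinct {V : Type*} {c : V → V → ℕ} {k t : ℕ} {S : Finset V}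
    {A : Finset ℕ} (h : RainbowTiling c k t S A) :
    ∃ (x : Fin k → Fin 3 → V) (y : Fin t → Fin 2 → V), ListsDistinct x y S ∧
      ListsDistinct (fun i (a : Fin 2) => c (x i a.castSucc) (x i a.succ))
        (fun j (_ : Fin 1) => c (y j 0) (y j 1)) A := by
  induction h with
  | empty =>
    refine ⟨fun i => i.elim0, fun j => j.elim0, ?_, ?_⟩ <;> simp [listsDistinct_iff]
  | @edge k t S A a b ha hb hab h hT ih =>
    obtain ⟨x, y, h1, h2⟩ := ih
    refine ⟨x, Fin.cons ![a, b] y, h1.cons_right _ ?_ ?_ ?_ sdiff_subset, ?_⟩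
    · intro i j; fin_cases i <;> fin_cases j <;> simp [hab, hab.symm]
    · intro i; fin_cases i <;> simp
    · intro i; fin_cases i <;> simp [ha, hb]
    · convert h2.cons_right (T := insert (c a b) A) (fun _ => c a b)
        (Function.injective_of_subsingleton _) (fun _ => h) (fun _ => by simp)
        (subset_insert _ _) using 1
      funext j
      exact Fin.cases rfl (fun _ => rfl) j
  | @path k t S A a b d ha hb hd hab hbd had h h' h'' hT ih =>
    obtain ⟨x, y, h1, h2⟩ := ih
    refine ⟨Fin.cons ![a, b, d] x, y, h1.cons_left _ ?_ ?_ ?_ sdiff_subset, ?_⟩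
    · intro i j; fin_cases i <;> fin_cases j <;> simp [hab, hbd, had, hab.symm, hbd.symm, had.symm]
    · intro i; fin_cases i <;> simp
    · intro i; fin_cases i <;> simp [ha, hb, hd]
    · convert h2.cons_left (T := insert (c a b) (insert (c b d) A)) ![c a b, c b d]
        ?_ ?_ ?_ ((subset_insert _ _).trans (subset_insert _ _)) using 1
      · funext i
        refine Fin.cases ?_ (fun _ => rfl) i
        funext j
        fin_cases j <;> rfl
      · intro i j; fin_cases i <;> fin_cases j <;> simp [h'', h''.symm]
      · intro i; fin_cases i <;> simp [h, h']
      · intro i; fin_cases i <;> simp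

end Embedding

section LinearForest

variable {k t n : ℕ}

theorem linearForest_edge {e : Sym2 (Fin k × Fin 3 ⊕ Fin t × Fin 2)}
    (he : e ∈ (linearForest k t).edgeSet) :
    (∃ (i : Fin k) (a : Fin 2), e = s(.inl (i, a.castSucc), .inl (i, a.succ))) ∨
      ∃ j : Fin t, e = s(.inr (j, 0), .inr (j, 1)) := by
  induction e with
  | h u v =>
    rw [mem_edgeSet, linearForest, fromRel_adj] at he
    have key : ∀ a b : Fin 3, (a : ℕ) + 1 = b → ∃ d : Fin 2, a = d.castSucc ∧ b = d.succ := by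
      decide
    rcases he.2 with (⟨i, a, b, rfl, rfl, h⟩ | ⟨j, rfl, rfl⟩) |
      (⟨i, a, b, rfl, rfl, h⟩ | ⟨j, rfl, rfl⟩)
    · obtain ⟨d, rfl, rfl⟩ := key a b h
      exact .inl ⟨i, d, rfl⟩
    · exact .inr ⟨j, rfl⟩
    · obtain ⟨d, rfl, rfl⟩ := key a b h
      exact .inl ⟨i, d, Sym2.eq_swap⟩
    · exact .inr ⟨j, Sym2.eq_swap⟩

theorem linearForest_exists_adj (u : Fin k × Fin 3 ⊕ Fin t × Fin 2) :
    ∃ v, (linearForest k t).Adj u v := by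
  rcases u with ⟨i, a⟩ | ⟨j, b⟩
  · obtain ⟨a', h⟩ : ∃ a' : Fin 3, (a : ℕ) + 1 = a' ∨ (a' : ℕ) + 1 = a := by
      revert a; decide
    refine ⟨.inl (i, a'), ?_⟩
    rw [linearForest, fromRel_adj]
    refine ⟨?_, h.imp (fun h => .inl ⟨i, a, a', rfl, rfl, h⟩)
      (fun h => .inl ⟨i, a', a, rfl, rfl, h⟩)⟩
    rintro h'
    simp only [Sum.inl.injEq, Prod.mk.injEq, true_and] at h'
    subst h'
    omega
  · fin_cases b
    · exact ⟨.inr (j, 1), by simp [linearForest]⟩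
    · exact ⟨.inr (j, 0), by simp [linearForest]⟩

theorem RainbowTiling.hasRainbowCopy {c : Sym2 (Fin n) → ℕ} {S : Finset (Fin n)} {A : Finset ℕ}
    (h : RainbowTiling (fun a b => c s(a, b)) k t S A) :
    HasRainbowCopy (linearForest k t) (⊤ : SimpleGraph (Fin n)) c := by
  obtain ⟨x, y, ⟨h1, -⟩, h2⟩ := h.exists_listsDistinct
  refine ⟨⟨Sum.elim (Function.uncurry x) (Function.uncurry y), fun h => h1.ne h.ne⟩, h1, ?_⟩
  rw [listsDistinct_iff] at h2
  obtain ⟨hx, hy, hxy, -, -⟩ := h2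
  intro e he e' he' hc
  rcases linearForest_edge he with ⟨i, a, rfl⟩ | ⟨j, rfl⟩ <;>
    rcases linearForest_edge he' with ⟨i', a', rfl⟩ | ⟨j', rfl⟩
  · obtain ⟨rfl, rfl⟩ := hx i a i' a' hc
    rfl
  · exact absurd hc (hxy i a j' 0)
  · exact absurd hc.symm (hxy i' a' j 0)
  · obtain ⟨rfl, -⟩ := hy j 0 j' 0 hc
    rfl

theorem colorCount_eq_card_cols (c : Sym2 (Fin n) → ℕ) :
    colorCount n c = (cols (fun a b => c s(a, b)) Finset.univ).card := by
  rw [colorCount, ← Set.ncard_coe_finset]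
  congr 1
  ext γ
  rw [Finset.mem_coe, mem_cols]
  constructor
  · rintro ⟨e, he, rfl⟩
    induction e with
    | h a b => exact ⟨a, Finset.mem_univ _, b, Finset.mem_univ _, by simpa using he, rfl⟩
  · rintro ⟨a, -, b, -, hab, rfl⟩
    exact ⟨s(a, b), by simpa using hab, rfl⟩

open Classical in
/-- The colouring of `K_n` that is rainbow on `T` and uses a single further colour elsewhere. -/
noncomputable def rainbowOn (T : Finset (Fin n)) (e : Sym2 (Fin n)) : ℕ :=
  if ∀ v ∈ e, v ∈ T then (Fintype.equivFin (Sym2 (Fin n)) e : ℕ) + 1 else 0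

theorem colorCount_rainbowOn {T : Finset (Fin n)} (hT : T.card + 2 ≤ n) :
    colorCount n (rainbowOn T) = T.card.choose 2 + 1 := by
  have hinj : Function.Injective fun e : Sym2 (Fin n) =>
      (Fintype.equivFin (Sym2 (Fin n)) e : ℕ) + 1 := fun e e' h => by
    simpa [Fin.val_inj] using h
  rw [← Sym2.card_image_offDiag, ← Finset.card_image_of_injective _ hinj, colorCount,
    ← Finset.card_insert_of_notMem (a := 0) (by simp), ← Set.ncard_coe_finset]
  congr 1
  ext γ
  simp only [Set.mem_image, Finset.coe_insert, Set.mem_insert_iff, Finset.coe_image]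
  constructor
  · rintro ⟨e, he, rfl⟩
    by_cases h : ∀ v ∈ e, v ∈ T
    · refine .inr ⟨e, ?_, by rw [rainbowOn, if_pos h]⟩
      induction e with
      | h a b =>
        refine ⟨(a, b), ?_, rfl⟩
        simp only [Sym2.mem_iff, forall_eq_or_imp, forall_eq] at h
        simpa [h] using he
    · exact .inl (by rw [rainbowOn, if_neg h])
  · rintro (rfl | ⟨e, ⟨⟨a, b⟩, hab, rfl⟩, rfl⟩)
    · have hc := Finset.card_compl T
      rw [Fintype.card_fin] at hc
      obtain ⟨a, ha, b, -, hab⟩ := Finset.one_lt_card.1 (by omega : 1 < Tᶜ.card)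
      refine ⟨s(a, b), by simpa using hab, if_neg fun h => ?_⟩
      exact Finset.mem_compl.1 ha (h a (Sym2.mem_mk_left a b))
    · simp only [Finset.coe_offDiag, Set.mem_offDiag, Finset.mem_coe] at hab
      refine ⟨s(a, b), by simpa using hab.2.2, if_pos ?_⟩
      simp only [Sym2.mem_iff, forall_eq_or_imp, forall_eq]
      exact ⟨hab.1, hab.2.1⟩

theorem not_hasRainbowCopy_rainbowOn {T : Finset (Fin n)} (hT : T.card + 3 = n)
    (hn : n = 3 * k + 2 * t) :
    ¬HasRainbowCopy (linearForest k t) (⊤ : SimpleGraph (Fin n)) (rainbowOn T) := by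
  rintro ⟨f, hf, hrainbow⟩
  have hsurj : Function.Surjective f :=
    ((Fintype.bijective_iff_injective_and_card f).2 ⟨hf, by simp [hn]; ring⟩).2
  have hc := Finset.card_compl T
  rw [Fintype.card_fin] at hc
  obtain ⟨x, y, z, hx, hy, hz, hxy, hxz, hyz⟩ :=
    Finset.two_lt_card_iff.1 (by omega : 2 < Tᶜ.card)
  have key : ∀ x ∈ Tᶜ, ∃ e ∈ (linearForest k t).edgeSet, x ∈ Sym2.map f e ∧
      rainbowOn T (Sym2.map f e) = 0 := by
    intro x hx
    obtain ⟨u, rfl⟩ := hsurj x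
    obtain ⟨v, huv⟩ := linearForest_exists_adj u
    exact ⟨s(u, v), huv, Sym2.mem_mk_left _ _,
      if_neg fun h => Finset.mem_compl.1 hx (h _ (Sym2.mem_mk_left _ _))⟩
  obtain ⟨e, he, hxe, h0⟩ := key x hx
  obtain ⟨e', he', hye, h0'⟩ := key y hy
  obtain ⟨e'', he'', hze, h0''⟩ := key z hz
  obtain rfl := hrainbow he he' (h0.trans h0'.symm)
  obtain rfl := hrainbow he he'' (h0.trans h0''.symm)
  rw [(Sym2.mem_and_mem_iff hxy).1 ⟨hxe, hye⟩, Sym2.mem_iff] at hze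
  rcases hze with rfl | rfl
  exacts [hxz rfl, hyz rfl]

end LinearForest

/-- For positive integers `k, t, n` with `k ≥ 1`, `t ≥ 2`, and `n = 3k + 2t`,
`AR(n, kP₃ ∪ tP₂) = (3k + 2t − 3)(3k + 2t − 4)/2 + 1`. -/
theorem antiRamsey_linearForest_spanning (k t n : ℕ) (hk : 1 ≤ k) (ht : 2 ≤ t)
    (hn : n = 3 * k + 2 * t) :
    antiRamsey n (linearForest k t) = (3 * k + 2 * t - 3) * (3 * k + 2 * t - 4) / 2 + 1 := by
  have hchoose : (3 * k + 2 * t - 3) * (3 * k + 2 * t - 4) / 2 = (n - 3).choose 2 := by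
    rw [Nat.choose_two_right, hn, Nat.sub_sub]
  rw [hchoose]
  refine IsGreatest.csSup_eq ⟨?_, ?_⟩
  · obtain ⟨T, -, hT⟩ := Finset.exists_subset_card_eq
      (by simp : n - 3 ≤ (Finset.univ : Finset (Fin n)).card)
    refine ⟨rainbowOn T, ?_, not_hasRainbowCopy_rainbowOn (by omega) hn⟩
    rw [colorCount_rainbowOn (by omega), hT]
  · rintro m ⟨c, rfl, hc⟩
    by_contra! h
    rw [colorCount_eq_card_cols] at h
    obtain ⟨A, hA⟩ := exists_rainbowTiling (k := k) (t := t) (S := Finset.univ)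
      (c := fun a b => c s(a, b)) (fun a b => by rw [Sym2.eq_swap]) hk (by omega) (.inr ht)
      (by simpa using hn) (by
        rw [Finset.card_fin]
        exact h)
    exact hc hA.hasRainbowCopy
end

section
/- Let k, t, n be positive integers with k ≥ 1, t ≥ 2, and n = 3k + 2t, and let c be an edge-coloring of the complete graph K_n such that the number of colors used satisfies |c(K_n)| ≥ (3k + 2t − 3)(3k + 2t − 4)/2 + 2. If K_{n−3} is a complete subgraph of K_n on n − 3 vertices chosen so that the number of colors |c(K_{n−3})| appearing on its edges is maximized among all complete subgraphs of K_n on n − 3 vertices, then |c(K_{n−3})| ≥ (3k + 2t − 6)(3k + 2t − 7)/2 + 2. -/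
open SimpleGraph

/-- The number of colors used by `c` on the edges of the complete subgraph of `K_n`
induced by the vertex set `s`. -/
noncomputable def colorCountOn (n : ℕ) (c : Sym2 (Fin n) → ℕ) (s : Finset (Fin n)) : ℕ :=
  (c '' {e | e ∈ (⊤ : SimpleGraph (Fin n)).edgeSet ∧ ∀ v ∈ e, v ∈ s}).ncard

/-- An edge avoids exactly `(n - 2).choose 3` of the three-element vertex sets. -/
theorem card_filter_triples_avoiding_edge {n : ℕ} (e : Sym2 (Fin n)) (he : ¬ e.IsDiag) :
    ((Finset.powersetCard 3 (Finset.univ : Finset (Fin n))).filter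
      (fun t => ∀ v ∈ e, v ∈ tᶜ)).card = (n - 2).choose 3 := by
  have h : (Finset.powersetCard 3 (Finset.univ : Finset (Fin n))).filter
      (fun t => ∀ v ∈ e, v ∈ tᶜ) = Finset.powersetCard 3 (e.toFinset)ᶜ := by
    ext t
    simp only [Finset.mem_filter, Finset.mem_powersetCard,
      Finset.mem_compl, Finset.subset_iff, Sym2.mem_toFinset]
    exact ⟨fun ⟨h1, h2⟩ => ⟨fun v hv hve => h2 v hve hv, h1.2⟩,
      fun ⟨h1, h2⟩ => ⟨⟨fun v _ => Finset.mem_univ v, h2⟩, fun v hve hv => h1 hv hve⟩⟩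
  rw [h, Finset.card_powersetCard, Finset.card_compl, Sym2.card_toFinset_of_not_isDiag e he,
    Fintype.card_fin]

/-- Choosing one edge of each color and averaging over the removed triples of vertices. -/
theorem colorCount_mul_choose_le_sum (n : ℕ) (c : Sym2 (Fin n) → ℕ) :
    colorCount n c * (n - 2).choose 3 ≤
      ∑ t ∈ Finset.powersetCard 3 (Finset.univ : Finset (Fin n)), colorCountOn n c tᶜ := by
  classical
  obtain ⟨E, hE, hbij⟩ :=
    (Set.surjOn_image c (⊤ : SimpleGraph (Fin n)).edgeSet).exists_bijOn_subset
  have hcard : colorCount n c = E.toFinset.card := by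
    rw [colorCount, ← hbij.image_eq, hbij.injOn.ncard_image,
      Set.ncard_eq_toFinset_card']
  have hle : ∀ t ∈ Finset.powersetCard 3 (Finset.univ : Finset (Fin n)),
      (E.toFinset.filter (fun e => ∀ v ∈ e, v ∈ tᶜ)).card ≤ colorCountOn n c tᶜ := by
    intro t _
    have hinj : Set.InjOn c (E.toFinset.filter (fun e => ∀ v ∈ e, v ∈ tᶜ) : Finset _) :=
      hbij.injOn.mono fun e he => by
        simpa using (Finset.mem_filter.1 (Finset.mem_coe.1 he)).1
    rw [← Set.ncard_coe_finset, ← hinj.ncard_image]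
    refine Set.ncard_le_ncard (Set.image_mono fun e he => ?_) (Set.toFinite _)
    obtain ⟨h1, h2⟩ := Finset.mem_filter.1 (Finset.mem_coe.1 he)
    exact ⟨hE (Set.mem_toFinset.1 h1), h2⟩
  calc colorCount n c * (n - 2).choose 3
      = ∑ e ∈ E.toFinset, ((Finset.powersetCard 3 (Finset.univ : Finset (Fin n))).filter
          (fun t => ∀ v ∈ e, v ∈ tᶜ)).card := by
        rw [hcard, Finset.sum_const_nat]
        intro e he
        exact card_filter_triples_avoiding_edge e
          (SimpleGraph.not_isDiag_of_mem_edgeSet _ (hE (Set.mem_toFinset.1 he)))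
    _ = ∑ t ∈ Finset.powersetCard 3 (Finset.univ : Finset (Fin n)),
          (E.toFinset.filter (fun e => ∀ v ∈ e, v ∈ tᶜ)).card :=
        Finset.sum_card_bipartiteAbove_eq_sum_card_bipartiteBelow
          (fun (e : Sym2 (Fin n)) (t : Finset (Fin n)) => ∀ v ∈ e, v ∈ tᶜ)
    _ ≤ _ := Finset.sum_le_sum hle

theorem six_mul_choose_three (m : ℕ) :
    6 * (m + 2).choose 3 = (m + 2) * (m + 1) * m := by
  have h := Nat.descFactorial_eq_factorial_mul_choose (m + 2) 3
  simp only [Nat.descFactorial, Nat.factorial] at h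
  simp only [Nat.add_sub_cancel, Nat.sub_zero,
    show m + 2 - 1 = m + 1 by omega] at h
  linarith

/-- If `k ≥ 1`, `t ≥ 2`, `n = 3k + 2t`, and `c` is an edge-coloring of `K_n` using at least
`(3k + 2t − 3)(3k + 2t − 4)/2 + 2` colors, then any complete subgraph on `n − 3` vertices
maximizing the number of colors on its edges carries at least
`(3k + 2t − 6)(3k + 2t − 7)/2 + 2` colors. -/
theorem colors_on_maximal_sub_complete (k t n : ℕ) (hk : 1 ≤ k) (ht : 2 ≤ t)
    (hn : n = 3 * k + 2 * t) (c : Sym2 (Fin n) → ℕ)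
    (hc : (3 * k + 2 * t - 3) * (3 * k + 2 * t - 4) / 2 + 2 ≤ colorCount n c)
    (s : Finset (Fin n)) (hs : s.card = n - 3)
    (hmax : ∀ s' : Finset (Fin n), s'.card = n - 3 →
      colorCountOn n c s' ≤ colorCountOn n c s) :
    (3 * k + 2 * t - 6) * (3 * k + 2 * t - 7) / 2 + 2 ≤ colorCountOn n c s := by
  have hbound : colorCount n c * (n - 2).choose 3 ≤ n.choose 3 * colorCountOn n c s := by
    refine (colorCount_mul_choose_le_sum n c).trans ?_
    have h := Finset.sum_le_card_nsmul
      (Finset.powersetCard 3 (Finset.univ : Finset (Fin n)))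
      (fun t => colorCountOn n c tᶜ) (colorCountOn n c s) fun t ht => hmax _ (by
        rw [Finset.card_compl, Fintype.card_fin, (Finset.mem_powersetCard.1 ht).2])
    simpa using h
  rw [← hn] at hc ⊢
  obtain ⟨r, hr⟩ : ∃ r, n = r + 7 := ⟨n - 7, by omega⟩
  have h1 := six_mul_choose_three (r + 3)
  have h2 := six_mul_choose_three (r + 5)
  rw [show n - 3 = r + 4 by omega, show n - 4 = r + 3 by omega] at hc
  rw [show n - 2 = r + 3 + 2 by omega,
    show n.choose 3 = (r + 5 + 2).choose 3 by rw [hr]] at hbound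
  rw [show n - 6 = r + 1 by omega, show n - 7 = r by omega]
  have hP : 2 * ((r + 4) * (r + 3) / 2) = (r + 4) * (r + 3) :=
    Nat.mul_div_cancel' (by simpa [mul_comm] using (Nat.even_mul_succ_self (r + 3)).two_dvd)
  have hQ : 2 * ((r + 1) * r / 2) = (r + 1) * r :=
    Nat.mul_div_cancel' (by simpa [mul_comm] using (Nat.even_mul_succ_self r).two_dvd)
  generalize (r + 4) * (r + 3) / 2 = P at *
  generalize (r + 1) * r / 2 = Q at *
  generalize colorCount n c = M at *
  generalize colorCountOn n c s = X at *
  have h3 : (r + 5) * (M * ((r + 4) * (r + 3))) ≤ (r + 5) * (X * ((r + 7) * (r + 6))) := by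
    calc (r + 5) * (M * ((r + 4) * (r + 3)))
        = 6 * (M * (r + 3 + 2).choose 3) := by
          rw [mul_left_comm 6, h1]
          ring
      _ ≤ 6 * ((r + 5 + 2).choose 3 * X) := Nat.mul_le_mul_left 6 hbound
      _ = _ := by
          rw [← mul_assoc, h2]
          ring
  have h4 := Nat.le_of_mul_le_mul_left h3 (by omega)
  by_contra! hX
  have h5 : 2 * X ≤ (r + 1) * r + 2 := by omega
  have h6 : (r + 4) * (r + 3) + 4 ≤ 2 * M := by omega
  have h7 := Nat.mul_le_mul_right ((r + 4) * (r + 3)) h6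
  have h8 := Nat.mul_le_mul_right ((r + 7) * (r + 6)) h5
  nlinarith
end
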